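/- arXiv:2003.07587 — 2 statements merged into one kernel-verified Lean document; each statement's English description precedes it below -/
import Mathlib

section
/- In the Mosco setting: (i) conditions (F1) and (F2) hold if and only if conditions (F1) and (F2') hold; and (ii) conditions (F1) and (F2) hold (i.e. ℰⁿ Mosco-converges to ℰ) if and only if condition (R) holds. -/
open Filter Topology
open scoped RealInnerProductSpace

noncomputable section

/-- The `𝓗`-norm associated to a bilinear form `E` with constant `α₀`:
`‖u‖_𝓗 = (ℰ^s_{α₀+1}(u,u))^{1/2} = (E(u,u) + (α₀+1)⟨u,u⟩_𝓛)^{1/2}`. -/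
def Hnorm {L : Type*} [NormedAddCommGroup L] [InnerProductSpace ℝ L]
    (E : L → L → ℝ) (α₀ : ℝ) (u : L) : ℝ :=
  Real.sqrt (E u u + (α₀ + 1) * ⟪u, u⟫)

/-- `(ℰ, 𝓗)` is a closed bilinear form on the real Hilbert space `L` with constants
`α₀ ∈ ℝ` and `K ≥ 1`: `𝓗` is a dense subspace, `E` is bilinear on `𝓗`, the symmetric part
`ℰ^s_{α₀}` is positive (hence `ℰ^s_{α₀+1}` is positive definite and dominates the `𝓛`-norm),
`𝓗` is complete for the `𝓗`-norm (ℰ.1), and the weak sector condition (ℰ.2) holds. -/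
structure IsClosedForm {L : Type*} [NormedAddCommGroup L] [InnerProductSpace ℝ L]
    (E : L → L → ℝ) (H : Submodule ℝ L) (α₀ K : ℝ) : Prop where
  one_le_K : 1 ≤ K
  dense_dom : Dense (H : Set L)
  add_left : ∀ u v w : L, u ∈ H → v ∈ H → w ∈ H → E (u + v) w = E u w + E v w
  add_right : ∀ u v w : L, u ∈ H → v ∈ H → w ∈ H → E u (v + w) = E u v + E u w
  smul_left : ∀ (c : ℝ) (u v : L), u ∈ H → v ∈ H → E (c • u) v = c * E u v
  smul_right : ∀ (c : ℝ) (u v : L), u ∈ H → v ∈ H → E u (c • v) = c * E u v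
  nonneg : ∀ u ∈ H, 0 ≤ E u u + α₀ * ⟪u, u⟫
  hilbert : ∀ u : ℕ → L, (∀ n, u n ∈ H) →
      (∀ ε > (0:ℝ), ∃ N : ℕ, ∀ m ≥ N, ∀ n ≥ N, Hnorm E α₀ (u m - u n) < ε) →
      ∃ l ∈ H, Tendsto (fun n => Hnorm E α₀ (u n - l)) atTop (𝓝 0)
  sector : ∀ u ∈ H, ∀ v ∈ H,
      |E u v + (α₀ + 1) * ⟪u, v⟫| ≤ K * Hnorm E α₀ u * Hnorm E α₀ v

/-- `Θ(u) = sup { ℰ_{α₀+1}(v,u) : v ∈ 𝓗, ‖v‖_𝓗 = 1 }`. -/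
def Theta {L : Type*} [NormedAddCommGroup L] [InnerProductSpace ℝ L]
    (E : L → L → ℝ) (H : Submodule ℝ L) (α₀ : ℝ) (u : L) : ℝ :=
  sSup {x : ℝ | ∃ v ∈ H, Hnorm E α₀ v = 1 ∧ x = E v u + (α₀ + 1) * ⟪v, u⟫}

/-- `(G_α)_{α > α₀}` is the resolvent associated to the closed form `(ℰ,𝓗)`:
`G_α(𝓛) ⊆ 𝓗`, `ℰ_α(G_α f, u) = ⟨f,u⟩_𝓛` for all `f ∈ 𝓛`, `u ∈ 𝓗`, the resolvent equation
`G_α − G_β + (α−β) G_α G_β = 0` holds, and `‖(α−α₀) G_α f‖_𝓛 ≤ ‖f‖_𝓛`. -/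
def IsResolventOf {L : Type*} [NormedAddCommGroup L] [InnerProductSpace ℝ L]
    (E : L → L → ℝ) (H : Submodule ℝ L) (α₀ : ℝ) (G : ℝ → L →ₗ[ℝ] L) : Prop :=
  (∀ α, α₀ < α → ∀ f : L, G α f ∈ H) ∧
  (∀ α, α₀ < α → ∀ f : L, ∀ u ∈ H, E (G α f) u + α * ⟪G α f, u⟫ = ⟪f, u⟫) ∧
  (∀ α β, α₀ < α → α₀ < β → ∀ f : L, G α f - G β f + (α - β) • G α (G β f) = 0) ∧
  (∀ α, α₀ < α → ∀ f : L, ‖(α - α₀) • G α f‖ ≤ ‖f‖)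

namespace IsClosedForm

variable {L : Type*} [NormedAddCommGroup L] [InnerProductSpace ℝ L]
  {E : L → L → ℝ} {H : Submodule ℝ L} {α₀ K : ℝ}

theorem inner_self_le (h : IsClosedForm E H α₀ K) {u : L} (hu : u ∈ H) :
    ⟪u, u⟫ ≤ E u u + (α₀ + 1) * ⟪u, u⟫ := by
  linarith [h.nonneg u hu]

theorem sq_Hnorm (h : IsClosedForm E H α₀ K) {u : L} (hu : u ∈ H) :
    Hnorm E α₀ u ^ 2 = E u u + (α₀ + 1) * ⟪u, u⟫ :=
  Real.sq_sqrt (real_inner_self_nonneg.trans (h.inner_self_le hu))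

theorem norm_le_Hnorm (h : IsClosedForm E H α₀ K) {u : L} (hu : u ∈ H) :
    ‖u‖ ≤ Hnorm E α₀ u := by
  refine Real.le_sqrt_of_sq_le ?_
  rw [← real_inner_self_eq_norm_sq]
  exact h.inner_self_le hu

theorem zero_left (h : IsClosedForm E H α₀ K) {u : L} (hu : u ∈ H) : E 0 u = 0 := by
  simpa using h.smul_left 0 u u hu hu

theorem sub_left (h : IsClosedForm E H α₀ K) {u v w : L} (hu : u ∈ H) (hv : v ∈ H)
    (hw : w ∈ H) : E (u - v) w = E u w - E v w := by
  have := h.add_left (u - v) v w (H.sub_mem hu hv) hv hw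
  rw [sub_add_cancel] at this
  linarith

theorem Hnorm_smul (h : IsClosedForm E H α₀ K) (c : ℝ) {u : L} (hu : u ∈ H) :
    Hnorm E α₀ (c • u) = |c| * Hnorm E α₀ u := by
  rw [Hnorm, h.smul_left c u _ hu (H.smul_mem c hu), h.smul_right c u u hu hu,
    real_inner_smul_left, real_inner_smul_right,
    show c * (c * E u u) + (α₀ + 1) * (c * (c * ⟪u, u⟫))
      = c ^ 2 * (E u u + (α₀ + 1) * ⟪u, u⟫) by ring,
    Real.sqrt_mul (sq_nonneg c), Real.sqrt_sq_eq_abs, Hnorm]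

theorem bddAbove_Theta (h : IsClosedForm E H α₀ K) {u : L} (hu : u ∈ H) :
    BddAbove {x : ℝ | ∃ v ∈ H, Hnorm E α₀ v = 1 ∧ x = E v u + (α₀ + 1) * ⟪v, u⟫} := by
  refine ⟨K * Hnorm E α₀ u, ?_⟩
  rintro _ ⟨v, hv, hv1, rfl⟩
  simpa [hv1] using (le_abs_self _).trans (h.sector v hv u hu)

/-- `ℰ_{α₀+1}(v, u) ≤ Θ(u) ‖v‖_𝓗`. -/
theorem le_Theta_mul (h : IsClosedForm E H α₀ K) {u v : L} (hu : u ∈ H) (hv : v ∈ H) :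
    E v u + (α₀ + 1) * ⟪v, u⟫ ≤ Theta E H α₀ u * Hnorm E α₀ v := by
  rcases eq_or_ne v 0 with rfl | hv0
  · simp [h.zero_left hu, Hnorm, h.zero_left H.zero_mem]
  have hpos : 0 < Hnorm E α₀ v := (norm_pos_iff.2 hv0).trans_le (h.norm_le_Hnorm hv)
  rw [← div_le_iff₀ hpos]
  refine le_csSup (h.bddAbove_Theta hu) ⟨(Hnorm E α₀ v)⁻¹ • v, H.smul_mem _ hv, ?_, ?_⟩
  · rw [h.Hnorm_smul _ hv, abs_of_pos (inv_pos.2 hpos), inv_mul_cancel₀ hpos.ne']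
  · rw [h.smul_left _ v u hv hu, real_inner_smul_left]
    field_simp

theorem Theta_le (h : IsClosedForm E H α₀ K) {u : L} {C : ℝ} (hC : 0 ≤ C)
    (hE : ∀ v ∈ H, E v u + (α₀ + 1) * ⟪v, u⟫ ≤ C * ‖v‖) : Theta E H α₀ u ≤ C := by
  refine Real.sSup_le ?_ hC
  rintro _ ⟨v, hv, hv1, rfl⟩
  calc _ ≤ C * ‖v‖ := hE v hv
    _ ≤ C * 1 := by gcongr; exact hv1 ▸ h.norm_le_Hnorm hv
    _ = C := mul_one C

theorem exists_abs_le_mul_Hnorm (h : IsClosedForm E H α₀ K) {u : L} (hu : u ∈ H) :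
    ∃ M, 0 ≤ M ∧ ∀ v ∈ H, |E v u| ≤ M * Hnorm E α₀ v := by
  have hK : 0 ≤ K := zero_le_one.trans h.one_le_K
  have hnn (v : L) : 0 ≤ Hnorm E α₀ v := Real.sqrt_nonneg _
  refine ⟨K * Hnorm E α₀ u + |α₀ + 1| * ‖u‖, by have := hnn u; positivity, fun v hv => ?_⟩
  have h1 : |⟪v, u⟫| ≤ Hnorm E α₀ v * ‖u‖ :=
    (abs_real_inner_le_norm v u).trans
      (mul_le_mul_of_nonneg_right (h.norm_le_Hnorm hv) (norm_nonneg u))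
  calc |E v u| = |(E v u + (α₀ + 1) * ⟪v, u⟫) - (α₀ + 1) * ⟪v, u⟫| := by ring_nf
    _ ≤ K * Hnorm E α₀ v * Hnorm E α₀ u + |α₀ + 1| * (Hnorm E α₀ v * ‖u‖) := by
      refine (abs_sub _ _).trans (add_le_add (h.sector v hv u hu) ?_)
      rw [abs_mul]
      gcongr
    _ = _ := by ring

/-- The form domain, as a type carrying the `𝓗`-norm rather than the ambient norm. -/
def Dom (_ : IsClosedForm E H α₀ K) : Type _ := H

variable (h : IsClosedForm E H α₀ K)

instance : AddCommGroup h.Dom := inferInstanceAs (AddCommGroup H)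

instance : Module ℝ h.Dom := inferInstanceAs (Module ℝ H)

/-- The inclusion of the form domain in the ambient Hilbert space. -/
def incl : h.Dom →ₗ[ℝ] L := H.subtype

theorem incl_mem (u : h.Dom) : h.incl u ∈ H := Subtype.property u

theorem exists_incl_eq {u : L} (hu : u ∈ H) : ∃ v : h.Dom, h.incl v = u := ⟨⟨u, hu⟩, rfl⟩

theorem incl_injective : Function.Injective h.incl := Subtype.val_injective

/-- The inner product `ℰ^s_{α₀+1}` on the form domain. -/
@[reducible] def core : InnerProductSpace.Core ℝ h.Dom where
  inner u v := (E (h.incl u) (h.incl v) + E (h.incl v) (h.incl u)) / 2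
    + (α₀ + 1) * ⟪h.incl u, h.incl v⟫
  conj_inner_symm u v := by
    simp only [conj_trivial, real_inner_comm]
    ring
  re_inner_nonneg u := by
    simpa using real_inner_self_nonneg.trans (h.inner_self_le (h.incl_mem u))
  add_left u v w := by
    rw [map_add, h.add_left _ _ _ (h.incl_mem u) (h.incl_mem v) (h.incl_mem w),
      h.add_right _ _ _ (h.incl_mem w) (h.incl_mem u) (h.incl_mem v), inner_add_left]
    ring
  smul_left u v c := by
    rw [map_smul, h.smul_left _ _ _ (h.incl_mem u) (h.incl_mem v),
      h.smul_right _ _ _ (h.incl_mem v) (h.incl_mem u), real_inner_smul_left]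
    simp only [conj_trivial]
    ring
  definite u hu := by
    have := h.inner_self_le (h.incl_mem u)
    have h0 : ⟪h.incl u, h.incl u⟫ = 0 :=
      le_antisymm (by rw [add_self_div_two] at hu; linarith) real_inner_self_nonneg
    exact h.incl_injective ((inner_self_eq_zero.1 h0).trans (map_zero _).symm)

instance : NormedAddCommGroup h.Dom := h.core.toNormedAddCommGroup

instance : InnerProductSpace ℝ h.Dom := InnerProductSpace.ofCore h.core.toCore

theorem norm_eq (u : h.Dom) : ‖u‖ = Hnorm E α₀ (h.incl u) := by
  rw [norm_eq_sqrt_real_inner, Hnorm]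
  congr 1
  change (E (h.incl u) (h.incl u) + E (h.incl u) (h.incl u)) / 2
    + (α₀ + 1) * ⟪h.incl u, h.incl u⟫ = _
  ring

theorem norm_incl_le (u : h.Dom) : ‖h.incl u‖ ≤ ‖u‖ :=
  (h.norm_le_Hnorm (h.incl_mem u)).trans_eq (h.norm_eq u).symm

instance : CompleteSpace h.Dom := by
  refine Metric.complete_of_cauchySeq_tendsto fun u hu => ?_
  rw [Metric.cauchySeq_iff] at hu
  obtain ⟨l, hl, hlim⟩ := h.hilbert (fun n => h.incl (u n)) (fun n => h.incl_mem _) fun ε hε => by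
    obtain ⟨N, hN⟩ := hu ε hε
    refine ⟨N, fun m hm n hn => ?_⟩
    simpa [dist_eq_norm, h.norm_eq] using hN m hm n hn
  obtain ⟨l, rfl⟩ := h.exists_incl_eq hl
  refine ⟨l, tendsto_iff_norm_sub_tendsto_zero.2 ?_⟩
  simpa [h.norm_eq] using hlim

/-- The Lax-Milgram theorem for `ℰ_α`, with the unknown in the second argument. -/
theorem exists_representation {α : ℝ} (hα : α₀ < α) (ℓ : StrongDual ℝ h.Dom) :
    ∃ w : h.Dom, ∀ v : h.Dom,
      E (h.incl v) (h.incl w) + α * ⟪h.incl v, h.incl w⟫ = ℓ v := by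
  let B₀ : h.Dom →ₗ[ℝ] h.Dom →ₗ[ℝ] ℝ := LinearMap.mk₂ ℝ
    (fun w v => E (h.incl v) (h.incl w) + α * ⟪h.incl v, h.incl w⟫)
    (fun u v w => by
      rw [map_add, h.add_right _ _ _ (h.incl_mem w) (h.incl_mem u) (h.incl_mem v),
        inner_add_right]
      ring)
    (fun c u v => by
      rw [map_smul, h.smul_right _ _ _ (h.incl_mem v) (h.incl_mem u), real_inner_smul_right,
        smul_eq_mul]
      ring)
    (fun u v w => by
      rw [map_add, h.add_left _ _ _ (h.incl_mem v) (h.incl_mem w) (h.incl_mem u),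
        inner_add_left]
      ring)
    (fun c u v => by
      rw [map_smul, h.smul_left _ _ _ (h.incl_mem v) (h.incl_mem u), real_inner_smul_left,
        smul_eq_mul]
      ring)
  have hB₀ (w v : h.Dom) : ‖B₀ w v‖ ≤ (K + |α - (α₀ + 1)|) * ‖w‖ * ‖v‖ := by
    have h1 := h.sector _ (h.incl_mem v) _ (h.incl_mem w)
    rw [← h.norm_eq, ← h.norm_eq] at h1
    have h2 : |⟪h.incl v, h.incl w⟫| ≤ ‖v‖ * ‖w‖ :=
      (abs_real_inner_le_norm _ _).trans
        (mul_le_mul (h.norm_incl_le v) (h.norm_incl_le w) (norm_nonneg _) (norm_nonneg _))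
    calc ‖B₀ w v‖ = |(E (h.incl v) (h.incl w) + (α₀ + 1) * ⟪h.incl v, h.incl w⟫)
          + (α - (α₀ + 1)) * ⟪h.incl v, h.incl w⟫| := by
            rw [Real.norm_eq_abs, LinearMap.mk₂_apply]; ring_nf
      _ ≤ K * ‖v‖ * ‖w‖ + |α - (α₀ + 1)| * (‖v‖ * ‖w‖) := by
            refine (abs_add_le _ _).trans (add_le_add h1 ?_)
            rw [abs_mul]
            gcongr
      _ = _ := by ring
  let B := B₀.mkContinuous₂ _ hB₀
  have hB (w v : h.Dom) : B w v = E (h.incl v) (h.incl w) + α * ⟪h.incl v, h.incl w⟫ := rfl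
  have hcoer : IsCoercive B := by
    refine ⟨min 1 (α - α₀), lt_min one_pos (sub_pos.2 hα), fun u => ?_⟩
    have h1 := h.nonneg _ (h.incl_mem u)
    have h2 : 0 ≤ ⟪h.incl u, h.incl u⟫ := real_inner_self_nonneg
    rw [hB, mul_assoc, ← sq, h.norm_eq, h.sq_Hnorm (h.incl_mem u)]
    have h3 := mul_le_mul_of_nonneg_right (min_le_left 1 (α - α₀)) h1
    have h4 := mul_le_mul_of_nonneg_right (min_le_right 1 (α - α₀)) h2
    nlinarith
  refine ⟨hcoer.continuousLinearEquivOfBilin.symm ((InnerProductSpace.toDual ℝ _).symm ℓ),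
    fun v => ?_⟩
  rw [← hB, ← hcoer.continuousLinearEquivOfBilin_apply, ContinuousLinearEquiv.apply_symm_apply,
    InnerProductSpace.toDual_symm_apply]

/-- The adjoint of the resolvent: it exists because `ℰ_α` is coercive. -/
theorem exists_coresolvent (h : IsClosedForm E H α₀ K) {α : ℝ} (hα : α₀ < α) (f : L) :
    ∃ w ∈ H, ∀ v ∈ H, E v w + α * ⟪v, w⟫ = ⟪f, v⟫ := by
  obtain ⟨w, hw⟩ := h.exists_representation hα
    ((innerSL ℝ f).comp (h.incl.mkContinuous 1 fun u => by simpa using h.norm_incl_le u))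
  refine ⟨h.incl w, h.incl_mem w, fun v hv => ?_⟩
  obtain ⟨v, rfl⟩ := h.exists_incl_eq hv
  simpa using hw v

theorem mem_of_forall_inner_le (h : IsClosedForm E H α₀ K) {G : ℝ → L →ₗ[ℝ] L}
    (hG : IsResolventOf E H α₀ G) {u : L} {C : ℝ}
    (hu : ∀ f, ⟪f, u⟫ ≤ C * Hnorm E α₀ (G (α₀ + 1) f)) : u ∈ H := by
  have hα : α₀ < α₀ + 1 := by linarith
  let J : L →ₗ[ℝ] h.Dom := (G (α₀ + 1)).codRestrict H (hG.1 _ hα)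
  have hJ (f : L) : h.incl (J f) = G (α₀ + 1) f := rfl
  have hJinj : Function.Injective J := by
    rw [← LinearMap.ker_eq_bot, LinearMap.ker_eq_bot']
    intro f hf
    have hGf : G (α₀ + 1) f = 0 := by rw [← hJ, hf, map_zero]
    refine h.dense_dom.eq_zero_of_inner_left (𝕜 := ℝ) fun v hv => ?_
    rw [← hG.2.1 _ hα f v hv, hGf, h.zero_left hv, inner_zero_left, mul_zero, add_zero]
  let e := LinearEquiv.ofInjective J hJinj
  let ℓ₀ : StrongDual ℝ (LinearMap.range J) :=
    ((innerₗ L u).comp e.symm.toLinearMap).mkContinuous C (by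
      intro x
      obtain ⟨f, rfl⟩ := e.surjective x
      have h1 := hu f
      have h2 := hu (-f)
      rw [← hJ, ← h.norm_eq] at h1 h2
      rw [map_neg, norm_neg, inner_neg_left] at h2
      simp only [LinearMap.comp_apply, LinearEquiv.coe_coe, LinearEquiv.symm_apply_apply,
        innerₗ_apply_apply, Real.norm_eq_abs]
      rw [real_inner_comm]
      exact abs_le'.2 ⟨h1, h2⟩)
  obtain ⟨ℓ, hℓ, -⟩ := exists_extension_norm_eq (LinearMap.range J) ℓ₀
  obtain ⟨w, hw⟩ := h.exists_representation hα ℓ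
  have : u = h.incl w := by
    refine ext_inner_left ℝ fun f => ?_
    rw [← hG.2.1 _ hα f _ (h.incl_mem w), ← hJ, hw, ← LinearEquiv.ofInjective_apply, hℓ]
    change _ = ⟪u, e.symm (e f)⟫
    rw [LinearEquiv.symm_apply_apply, real_inner_comm]
  exact this ▸ h.incl_mem w

theorem exists_resolvent_Hnorm_sub_lt (h : IsClosedForm E H α₀ K) {G : ℝ → L →ₗ[ℝ] L}
    (hG : IsResolventOf E H α₀ G) {v : L} (hv : v ∈ H) {ε : ℝ} (hε : 0 < ε) :
    ∃ f, Hnorm E α₀ (v - G (α₀ + 1) f) < ε := by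
  have hα : α₀ < α₀ + 1 := by linarith
  let J : L →ₗ[ℝ] h.Dom := (G (α₀ + 1)).codRestrict H (hG.1 _ hα)
  have hJ (f : L) : h.incl (J f) = G (α₀ + 1) f := rfl
  have hdense : Dense (LinearMap.range J : Set h.Dom) := by
    rw [Submodule.dense_iff_topologicalClosure_eq_top,
      Submodule.topologicalClosure_eq_top_iff, Submodule.eq_bot_iff]
    intro x hx
    obtain ⟨w, hw⟩ := h.exists_representation hα (innerSL ℝ x)
    have hw0 : h.incl w = 0 := by
      refine ext_inner_left ℝ fun f => ?_
      rw [← hG.2.1 _ hα f _ (h.incl_mem w), ← hJ, hw, innerSL_apply_apply, inner_zero_right,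
        real_inner_comm]
      exact hx _ ⟨f, rfl⟩
    have hxx := hw x
    rw [innerSL_apply_apply, hw0, inner_zero_right, mul_zero, add_zero] at hxx
    have hE0 : E (h.incl x) 0 = 0 := by
      simpa using h.smul_right 0 _ _ (h.incl_mem x) (h.incl_mem x)
    exact inner_self_eq_zero.1 (hxx.symm.trans hE0)
  obtain ⟨v, rfl⟩ := h.exists_incl_eq hv
  obtain ⟨_, ⟨f, rfl⟩, hf⟩ := hdense.exists_dist_lt v hε
  exact ⟨f, by rwa [dist_eq_norm, h.norm_eq, map_sub, hJ] at hf⟩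

end IsClosedForm

theorem tendsto_of_tendsto_comp_of_eq_off_range {X : Type*} {l : Filter X} {x y : ℕ → X}
    {nk : ℕ → ℕ} (hnk : StrictMono nk) (hx : Tendsto (fun k => x (nk k)) atTop l)
    (hy : Tendsto y atTop l) (hxy : ∀ n, n ∉ Set.range nk → x n = y n) :
    Tendsto x atTop l := by
  intro s hs
  obtain ⟨k₀, hk₀⟩ := eventually_atTop.1 (hx hs)
  rw [mem_map]
  filter_upwards [hy hs, eventually_ge_atTop (nk k₀)] with n hn hn'
  by_cases hr : n ∈ Set.range nk
  · obtain ⟨k, rfl⟩ := hr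
    exact hk₀ k (hnk.le_iff_le.1 hn')
  · rw [Set.mem_preimage, hxy n hr]
    exact hn

theorem exists_extension_of_injective {X : ℕ → Type*} {nk : ℕ → ℕ}
    (hnk : Function.Injective nk) (v : ∀ k, X (nk k)) (y : ∀ n, X n) :
    ∃ w : ∀ n, X n, (∀ k, w (nk k) = v k) ∧ ∀ n, n ∉ Set.range nk → w n = y n := by
  have hex : ∀ n, ∃ z : X n, (∀ k (hk : nk k = n), z = hk ▸ v k) ∧
      (n ∉ Set.range nk → z = y n) := by
    intro n
    by_cases hn : n ∈ Set.range nk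
    · obtain ⟨k, rfl⟩ := hn
      refine ⟨v k, fun j hj => ?_, fun hk => (hk ⟨k, rfl⟩).elim⟩
      obtain rfl := hnk hj
      rfl
    · exact ⟨y n, fun k hk => (hn ⟨k, hk⟩).elim, fun _ => rfl⟩
  choose w hw hw' using hex
  exact ⟨w, fun k => hw _ k rfl, hw'⟩

/-- Approximate minimizers of `err n` under the constraint `P n` drive the error to zero as soon
as arbitrarily small errors are eventually attainable. -/
theorem exists_seq_tendsto_zero {X : ℕ → Type*} {P : ∀ n, X n → Prop} {err : ∀ n, X n → ℝ}
    (hP : ∀ n, ∃ x, P n x) (herr : ∀ n x, 0 ≤ err n x)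
    (hsmall : ∀ ε > 0, ∀ᶠ n in atTop, ∃ x, P n x ∧ err n x < ε) :
    ∃ x : ∀ n, X n, (∀ n, P n (x n)) ∧ Tendsto (fun n => err n (x n)) atTop (𝓝 0) := by
  let e (n : ℕ) : ℝ := ⨅ x : {x // P n x}, err n x
  have hbdd (n : ℕ) : BddBelow (Set.range fun x : {x // P n x} => err n x) :=
    ⟨0, by rintro _ ⟨x, rfl⟩; exact herr n x⟩
  have hex (n : ℕ) : ∃ x, P n x ∧ err n x < e n + 1 / (n + 1 : ℝ) := by
    have : Nonempty {x // P n x} := let ⟨x, hx⟩ := hP n; ⟨⟨x, hx⟩⟩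
    obtain ⟨x, hx⟩ := exists_lt_of_ciInf_lt
      (show e n < e n + 1 / (n + 1 : ℝ) from lt_add_of_pos_right _ (by positivity))
    exact ⟨x, x.2, hx⟩
  choose x hx hxe using hex
  refine ⟨x, hx, ?_⟩
  have he : Tendsto e atTop (𝓝 0) := by
    refine tendsto_order.2 ⟨fun a ha => ?_, fun ε hε => ?_⟩
    · exact Eventually.of_forall fun n => ha.trans_le (Real.iInf_nonneg fun x => herr n x)
    · filter_upwards [hsmall ε hε] with n ⟨z, hz, hzε⟩
      exact (ciInf_le (hbdd n) ⟨z, hz⟩).trans_lt hzε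
  exact squeeze_zero (fun n => herr n _) (fun n => (hxe n).le)
    (by simpa using he.add tendsto_one_div_add_atTop_nhds_zero_nat)

section MoscoSetting

variable {𝓛 : ℕ → Type*} [∀ n, NormedAddCommGroup (𝓛 n)] [∀ n, InnerProductSpace ℝ (𝓛 n)]
variable {𝓛₀ : Type*} [NormedAddCommGroup 𝓛₀] [InnerProductSpace ℝ 𝓛₀]

/-- Strong convergence of `u_n ∈ 𝓛_n` to `u₀ ∈ 𝓛₀`: `‖Φ_n u₀ − u_n‖ → 0`. -/
def SConv (Φ : ∀ n, 𝓛₀ → 𝓛 n) (u : ∀ n, 𝓛 n) (u₀ : 𝓛₀) : Prop :=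
  Tendsto (fun n => ‖Φ n u₀ - u n‖) atTop (𝓝 0)

/-- Weak convergence of `u_n ∈ 𝓛_n` to `u₀ ∈ 𝓛₀`: `⟨u_n, v_n⟩ → ⟨u₀, v₀⟩` for every
strongly converging sequence `v_n → v₀`. -/
def WConv (Φ : ∀ n, 𝓛₀ → 𝓛 n) (u : ∀ n, 𝓛 n) (u₀ : 𝓛₀) : Prop :=
  ∀ (v : ∀ n, 𝓛 n) (v₀ : 𝓛₀), SConv Φ v v₀ →
    Tendsto (fun n => ⟪u n, v n⟫) atTop (𝓝 ⟪u₀, v₀⟫)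

/-- Condition (F1): if `u_n ∈ 𝓗_n` converges weakly to `u₀` and
`liminf_n Θⁿ(u_n) < ∞`, then `u₀ ∈ 𝓗`. -/
def CondF1 (Φ : ∀ n, 𝓛₀ → 𝓛 n) (E : ∀ n, 𝓛 n → 𝓛 n → ℝ)
    (H : ∀ n, Submodule ℝ (𝓛 n)) (H₀ : Submodule ℝ 𝓛₀) (α₀ : ℝ) : Prop :=
  ∀ (u : ∀ n, 𝓛 n) (u₀ : 𝓛₀), (∀ n, u n ∈ H n) → WConv Φ u u₀ →
    Filter.liminf (fun n => ((Theta (E n) (H n) α₀ (u n) : ℝ) : EReal)) atTop < ⊤ →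
    u₀ ∈ H₀

/-- Condition (F2): for every sequence `u_n ∈ 𝓗_n` weakly converging to some `u₀ ∈ 𝓗` and
every `v₀ ∈ 𝓗`, there is a sequence `v_n ∈ 𝓗_n` converging strongly to `v₀` with
`ℰⁿ(v_n, u_n) → ℰ(v₀, u₀)`. -/
def CondF2 (Φ : ∀ n, 𝓛₀ → 𝓛 n) (E : ∀ n, 𝓛 n → 𝓛 n → ℝ)
    (H : ∀ n, Submodule ℝ (𝓛 n)) (E₀ : 𝓛₀ → 𝓛₀ → ℝ) (H₀ : Submodule ℝ 𝓛₀) : Prop :=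
  ∀ (u : ∀ n, 𝓛 n) (u₀ : 𝓛₀), (∀ n, u n ∈ H n) → u₀ ∈ H₀ → WConv Φ u u₀ →
    ∀ v₀ ∈ H₀, ∃ v : ∀ n, 𝓛 n, (∀ n, v n ∈ H n) ∧ SConv Φ v v₀ ∧
      Tendsto (fun n => E n (v n) (u n)) atTop (𝓝 (E₀ v₀ u₀))

/-- Condition (F2'): for `n_k ↑ ∞` and `u_k ∈ 𝓗_{n_k}` weakly converging to some `u₀ ∈ 𝓗`
with `sup_k Θ^{n_k}(u_k) < ∞`, there is a subset `C` of `𝓗`, dense in `(𝓗, ‖·‖_𝓗)`, such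
that for every `v₀ ∈ C` there is a sequence `v_k ∈ 𝓗_{n_k}` converging strongly to `v₀` with
`liminf_k ℰ^{n_k}(v_k, u_k) ≤ ℰ(v₀, u₀)`. -/
def CondF2' (Φ : ∀ n, 𝓛₀ → 𝓛 n) (E : ∀ n, 𝓛 n → 𝓛 n → ℝ)
    (H : ∀ n, Submodule ℝ (𝓛 n)) (E₀ : 𝓛₀ → 𝓛₀ → ℝ) (H₀ : Submodule ℝ 𝓛₀)
    (α₀ : ℝ) : Prop :=
  ∀ nk : ℕ → ℕ, StrictMono nk →
    ∀ (u : ∀ k, 𝓛 (nk k)) (u₀ : 𝓛₀),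
      (∀ k, u k ∈ H (nk k)) → u₀ ∈ H₀ →
      WConv (fun k => Φ (nk k)) u u₀ →
      (∃ C : ℝ, ∀ k, Theta (E (nk k)) (H (nk k)) α₀ (u k) ≤ C) →
      ∃ C : Set 𝓛₀, C ⊆ (H₀ : Set 𝓛₀) ∧
        (∀ w ∈ H₀, ∀ ε > (0:ℝ), ∃ v₀ ∈ C, Hnorm E₀ α₀ (w - v₀) < ε) ∧
        ∀ v₀ ∈ C, ∃ v : ∀ k, 𝓛 (nk k),
          (∀ k, v k ∈ H (nk k)) ∧ SConv (fun k => Φ (nk k)) v v₀ ∧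
          Filter.liminf (fun k => ((E (nk k) (v k) (u k) : ℝ) : EReal)) atTop
            ≤ ((E₀ v₀ u₀ : ℝ) : EReal)

/-- Condition (R): for every `α > α₀`, `Gⁿ_α` converges strongly to `G_α`. -/
def CondR (Φ : ∀ n, 𝓛₀ → 𝓛 n) (G : ∀ n, ℝ → 𝓛 n →ₗ[ℝ] 𝓛 n)
    (G₀ : ℝ → 𝓛₀ →ₗ[ℝ] 𝓛₀) (α₀ : ℝ) : Prop :=
  ∀ α, α₀ < α → ∀ (u : ∀ n, 𝓛 n) (u₀ : 𝓛₀), SConv Φ u u₀ →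
    SConv Φ (fun n => G n α (u n)) (G₀ α u₀)

theorem sconv_apply (Φ : ∀ n, 𝓛₀ →ₗ[ℝ] 𝓛 n) (w : 𝓛₀) :
    SConv (fun n => ⇑(Φ n)) (fun n => Φ n w) w := by
  simp [SConv]

theorem SConv.comp {Φ : ∀ n, 𝓛₀ →ₗ[ℝ] 𝓛 n} {v : ∀ n, 𝓛 n} {v₀ : 𝓛₀}
    (hv : SConv (fun n => ⇑(Φ n)) v v₀) {nk : ℕ → ℕ} (hnk : StrictMono nk) :
    SConv (fun k => ⇑(Φ (nk k))) (fun k => v (nk k)) v₀ :=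
  Tendsto.comp hv hnk.tendsto_atTop

theorem WConv.comp {Φ : ∀ n, 𝓛₀ →ₗ[ℝ] 𝓛 n} {u : ∀ n, 𝓛 n} {u₀ : 𝓛₀}
    (hu : WConv (fun n => ⇑(Φ n)) u u₀) {nk : ℕ → ℕ} (hnk : StrictMono nk) :
    WConv (fun k => ⇑(Φ (nk k))) (fun k => u (nk k)) u₀ := by
  intro v v₀ hv
  obtain ⟨w, hw, hw'⟩ := exists_extension_of_injective hnk.injective v fun n => Φ n v₀
  have hwS : SConv (fun n => ⇑(Φ n)) w v₀ := by
    refine tendsto_of_tendsto_comp_of_eq_off_range hnk ?_ (sconv_apply Φ v₀) fun n hn => ?_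
    · simpa only [hw, SConv] using hv
    · simp only [hw' n hn]
  simpa only [hw, Function.comp_def] using (hu w v₀ hwS).comp hnk.tendsto_atTop

/-- Weakly convergent sequences are bounded. -/
theorem WConv.exists_norm_le {Φ : ∀ n, 𝓛₀ →ₗ[ℝ] 𝓛 n} {u : ∀ n, 𝓛 n} {u₀ : 𝓛₀}
    (hu : WConv (fun n => ⇑(Φ n)) u u₀) : ∃ C, ∀ n, ‖u n‖ ≤ C := by
  by_contra hC
  have hfreq (k : ℕ) : ∃ᶠ n in atTop, ((k : ℝ) + 1) ^ 2 < ‖u n‖ := by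
    intro hev
    have hb : IsBoundedUnder (· ≤ ·) atTop fun n => ‖u n‖ :=
      ⟨((k : ℝ) + 1) ^ 2, eventually_map.2 (hev.mono fun n hn => not_lt.1 hn)⟩
    obtain ⟨C, hC'⟩ := hb.bddAbove_range
    exact hC ⟨C, fun n => hC' ⟨n, rfl⟩⟩
  obtain ⟨nk, hnk, hlarge⟩ := extraction_forall_of_frequently hfreq
  have hpos (k : ℕ) : 0 < ‖u (nk k)‖ := lt_trans (by positivity) (hlarge k)
  have hv : SConv (fun k => ⇑(Φ (nk k)))
      (fun k => (((k : ℝ) + 1) / ‖u (nk k)‖ ^ 2) • u (nk k)) 0 := by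
    refine squeeze_zero (fun k => norm_nonneg _) (fun k => ?_)
      tendsto_one_div_add_atTop_nhds_zero_nat
    have := hpos k
    dsimp only
    rw [map_zero, zero_sub, norm_neg, norm_smul, Real.norm_of_nonneg (by positivity),
      show ((k : ℝ) + 1) / ‖u (nk k)‖ ^ 2 * ‖u (nk k)‖ = ((k : ℝ) + 1) / ‖u (nk k)‖ by
        field_simp, div_le_div_iff₀ this (by positivity)]
    nlinarith [hlarge k]
  have hlim := hu.comp hnk _ _ hv
  have heq (k : ℕ) :
      ⟪u (nk k), (((k : ℝ) + 1) / ‖u (nk k)‖ ^ 2) • u (nk k)⟫ = (k : ℝ) + 1 := by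
    have := hpos k
    rw [real_inner_smul_right, real_inner_self_eq_norm_sq]
    field_simp
  simp only [heq] at hlim
  exact not_tendsto_nhds_of_tendsto_atTop
    (tendsto_natCast_atTop_atTop.atTop_add tendsto_const_nhds) _ hlim

section Linear

variable {Φ : ∀ n, 𝓛₀ →ₗ[ℝ] 𝓛 n}

theorem tendsto_inner_map (hΦ : ∀ w : 𝓛₀, Tendsto (fun n => ‖Φ n w‖) atTop (𝓝 ‖w‖))
    (x y : 𝓛₀) : Tendsto (fun n => ⟪Φ n x, Φ n y⟫) atTop (𝓝 ⟪x, y⟫) := by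
  simp only [real_inner_eq_norm_add_mul_self_sub_norm_mul_self_sub_norm_mul_self_div_two,
    ← map_add]
  exact (((((hΦ _).mul (hΦ _)).sub ((hΦ _).mul (hΦ _))).sub ((hΦ _).mul (hΦ _))).div_const 2)

theorem SConv.tendsto_norm (hΦ : ∀ w : 𝓛₀, Tendsto (fun n => ‖Φ n w‖) atTop (𝓝 ‖w‖))
    {u : ∀ n, 𝓛 n} {u₀ : 𝓛₀} (hu : SConv (fun n => ⇑(Φ n)) u u₀) :
    Tendsto (fun n => ‖u n‖) atTop (𝓝 ‖u₀‖) := by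
  refine tendsto_of_tendsto_of_dist (hΦ u₀) (squeeze_zero (fun _ => dist_nonneg) (fun n => ?_) hu)
  exact abs_norm_sub_norm_le _ _

theorem tendsto_inner_of_sconv {u v : ∀ n, 𝓛 n} {v₀ : 𝓛₀} {a C : ℝ} (hC : ∀ n, ‖u n‖ ≤ C)
    (hv : SConv (fun n => ⇑(Φ n)) v v₀)
    (h : Tendsto (fun n => ⟪u n, Φ n v₀⟫) atTop (𝓝 a)) :
    Tendsto (fun n => ⟪u n, v n⟫) atTop (𝓝 a) := by
  refine tendsto_of_tendsto_of_dist h (squeeze_zero (fun _ => dist_nonneg) (fun n => ?_)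
    (by simpa using Tendsto.const_mul C hv))
  rw [Real.dist_eq, ← inner_sub_right]
  exact (abs_real_inner_le_norm _ _).trans
    (mul_le_mul_of_nonneg_right (hC n) (norm_nonneg _))

theorem SConv.wconv (hΦ : ∀ w : 𝓛₀, Tendsto (fun n => ‖Φ n w‖) atTop (𝓝 ‖w‖))
    {u : ∀ n, 𝓛 n} {u₀ : 𝓛₀} (hu : SConv (fun n => ⇑(Φ n)) u u₀) :
    WConv (fun n => ⇑(Φ n)) u u₀ := by
  intro v v₀ hv
  obtain ⟨C, hC⟩ := (hu.tendsto_norm hΦ).bddAbove_range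
  obtain ⟨D, hD⟩ := (hΦ v₀).bddAbove_range
  refine tendsto_inner_of_sconv (fun n => hC ⟨n, rfl⟩) hv ?_
  simp only [real_inner_comm (Φ _ v₀), real_inner_comm v₀]
  refine tendsto_inner_of_sconv (fun n => hD ⟨n, rfl⟩) hu ?_
  exact tendsto_inner_map hΦ v₀ u₀

theorem WConv.sconv (hΦ : ∀ w : 𝓛₀, Tendsto (fun n => ‖Φ n w‖) atTop (𝓝 ‖w‖))
    {u : ∀ n, 𝓛 n} {u₀ : 𝓛₀} (hu : WConv (fun n => ⇑(Φ n)) u u₀)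
    (hnorm : Tendsto (fun n => ⟪u n, u n⟫) atTop (𝓝 ⟪u₀, u₀⟫)) :
    SConv (fun n => ⇑(Φ n)) u u₀ := by
  have h1 := ((tendsto_inner_map hΦ u₀ u₀).sub
    ((hu _ _ (sconv_apply _ u₀)).const_mul 2)).add hnorm
  have h2 := h1.sqrt
  rw [show ⟪u₀, u₀⟫ - 2 * ⟪u₀, u₀⟫ + ⟪u₀, u₀⟫ = 0 by ring, Real.sqrt_zero] at h2
  refine h2.congr fun n => ?_
  rw [norm_eq_sqrt_real_inner, real_inner_sub_sub_self, real_inner_comm (u n) (Φ n u₀)]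

/-- Bounded sequences have weakly convergent subsequences. -/
theorem exists_subseq_wconv [CompleteSpace 𝓛₀] [TopologicalSpace.SeparableSpace 𝓛₀]
    (hΦ : ∀ w : 𝓛₀, Tendsto (fun n => ‖Φ n w‖) atTop (𝓝 ‖w‖))
    {u : ∀ n, 𝓛 n} {C : ℝ} (hC : ∀ n, ‖u n‖ ≤ C) :
    ∃ (nk : ℕ → ℕ) (u₀ : 𝓛₀), StrictMono nk ∧
      WConv (fun k => ⇑(Φ (nk k))) (fun k => u (nk k)) u₀ := by
  have hC0 : 0 ≤ C := (norm_nonneg _).trans (hC 0)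
  let U : Ultrafilter ℕ := hyperfilter ℕ
  have hU : (U : Filter ℕ) ≤ atTop := by
    rw [← Nat.cofinite_eq_atTop]; exact hyperfilter_le_cofinite
  have hle (n : ℕ) (x : 𝓛₀) : |⟪u n, Φ n x⟫| ≤ C * ‖Φ n x‖ :=
    (abs_real_inner_le_norm _ _).trans (mul_le_mul_of_nonneg_right (hC n) (norm_nonneg _))
  have hex (x : 𝓛₀) : ∃ a, Tendsto (fun n => ⟪u n, Φ n x⟫) U (𝓝 a) := by
    obtain ⟨D, hD⟩ := (hΦ x).bddAbove_range
    obtain ⟨a, -, ha⟩ := (isCompact_Icc (a := -(C * D)) (b := C * D)).ultrafilter_le_nhds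
      (U.map fun n => ⟪u n, Φ n x⟫) (by
        rw [Ultrafilter.coe_map]
        refine tendsto_principal.2 (Eventually.of_forall fun n => abs_le.1 ?_)
        exact (hle n x).trans (mul_le_mul_of_nonneg_left (hD ⟨n, rfl⟩) hC0))
    exact ⟨a, ha⟩
  choose ℓ hℓ using hex
  have hℓC (x : 𝓛₀) : |ℓ x| ≤ C * ‖x‖ := by
    have h1 : Tendsto (fun n => |⟪u n, Φ n x⟫|) U (𝓝 |ℓ x|) := (hℓ x).abs
    exact le_of_tendsto_of_tendsto' h1 (((hΦ x).mono_left hU).const_mul C) fun n => hle n x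
  let ℓ' : StrongDual ℝ 𝓛₀ := LinearMap.mkContinuous
    { toFun := ℓ
      map_add' := fun x y => tendsto_nhds_unique (hℓ (x + y)) (by
        simpa [inner_add_right] using (hℓ x).add (hℓ y))
      map_smul' := fun c x => tendsto_nhds_unique (hℓ (c • x)) (by
        simpa [real_inner_smul_right] using (hℓ x).const_mul c) } C hℓC
  let u₀ : 𝓛₀ := (InnerProductSpace.toDual ℝ 𝓛₀).symm ℓ'
  have hu₀ (x : 𝓛₀) : Tendsto (fun n => ⟪u n, Φ n x⟫) U (𝓝 ⟪u₀, x⟫) := by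
    rw [InnerProductSpace.toDual_symm_apply]
    exact hℓ x
  let d := TopologicalSpace.denseSeq 𝓛₀
  have hcl : MapClusterPt (fun j => ⟪u₀, d j⟫) atTop fun n j => ⟪u n, Φ n (d j)⟫ :=
    MapClusterPt.mono (Tendsto.mapClusterPt (tendsto_pi_nhds.2 fun j => hu₀ (d j))) hU
  obtain ⟨nk, hnk, hlim⟩ := hcl.tendsto_subseq
  refine ⟨nk, u₀, hnk, fun v v₀ hv => ?_⟩
  refine tendsto_inner_of_sconv (𝓛 := fun k => 𝓛 (nk k)) (Φ := fun k => Φ (nk k))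
    (fun k => hC (nk k)) hv ?_
  have hΦk (x : 𝓛₀) : Tendsto (fun k => ‖Φ (nk k) x‖) atTop (𝓝 ‖x‖) :=
    (hΦ x).comp hnk.tendsto_atTop
  refine Metric.tendsto_nhds.2 fun ε hε => ?_
  have hden : 0 < C + ‖u₀‖ + 1 := by positivity
  obtain ⟨j, hj⟩ := (TopologicalSpace.denseRange_denseSeq 𝓛₀).exists_dist_lt v₀
    (show 0 < ε / 2 / (C + ‖u₀‖ + 1) by positivity)
  rw [dist_eq_norm, lt_div_iff₀ hden] at hj
  have hj' : C * ‖v₀ - d j‖ + ‖u₀‖ * ‖v₀ - d j‖ < ε / 2 := by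
    have := norm_nonneg (v₀ - d j)
    change ‖v₀ - d j‖ * _ < _ at hj
    linarith
  filter_upwards [((hΦk (v₀ - d j)).const_mul C).eventually_lt_const
      (show C * ‖v₀ - d j‖ < ε / 2 - ‖u₀‖ * ‖v₀ - d j‖ by linarith),
    Metric.tendsto_nhds.1 (tendsto_pi_nhds.1 hlim j) (ε / 2) (half_pos hε)] with k h1 h2
  have h3 := hle (nk k) (v₀ - d j)
  have h4 := abs_real_inner_le_norm u₀ (v₀ - d j)
  rw [map_sub, inner_sub_right] at h3
  rw [inner_sub_right] at h4
  rw [Real.dist_eq] at h2 ⊢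
  rw [map_sub] at h1
  simp only [Function.comp_apply] at h2
  rw [abs_le] at h3 h4
  rw [abs_lt] at h2 ⊢
  constructor <;> linarith

variable {H : ∀ n, Submodule ℝ (𝓛 n)}

theorem exists_mem_sconv (hH : ∀ n, Dense (H n : Set (𝓛 n))) (w : 𝓛₀) :
    ∃ y : ∀ n, 𝓛 n, (∀ n, y n ∈ H n) ∧ SConv (fun n => ⇑(Φ n)) y w := by
  have hex (n : ℕ) : ∃ y ∈ H n, dist (Φ n w) y < 1 / (n + 1 : ℝ) :=
    (hH n).exists_dist_lt _ (by positivity)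
  choose y hy hyd using hex
  refine ⟨y, hy, squeeze_zero (fun _ => norm_nonneg _) (fun n => ?_)
    tendsto_one_div_add_atTop_nhds_zero_nat⟩
  rw [← dist_eq_norm]
  exact (hyd n).le

/-- A weakly convergent sequence given along a subsequence extends to all indices. -/
theorem exists_extension_wconv (hΦ : ∀ w : 𝓛₀, Tendsto (fun n => ‖Φ n w‖) atTop (𝓝 ‖w‖))
    (hH : ∀ n, Dense (H n : Set (𝓛 n))) {nk : ℕ → ℕ} (hnk : StrictMono nk)
    {u : ∀ k, 𝓛 (nk k)} {u₀ : 𝓛₀} (huH : ∀ k, u k ∈ H (nk k))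
    (hu : WConv (fun k => ⇑(Φ (nk k))) u u₀) :
    ∃ w : ∀ n, 𝓛 n, (∀ k, w (nk k) = u k) ∧ (∀ n, w n ∈ H n) ∧
      WConv (fun n => ⇑(Φ n)) w u₀ := by
  obtain ⟨y, hyH, hy⟩ := exists_mem_sconv (Φ := Φ) hH u₀
  obtain ⟨w, hw, hw'⟩ := exists_extension_of_injective hnk.injective u y
  refine ⟨w, hw, fun n => ?_, fun v v₀ hv => ?_⟩
  · by_cases hn : n ∈ Set.range nk
    · obtain ⟨k, rfl⟩ := hn
      exact hw k ▸ huH k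
    · exact hw' n hn ▸ hyH n
  · refine tendsto_of_tendsto_comp_of_eq_off_range hnk ?_ (hy.wconv hΦ v v₀ hv) fun n hn => ?_
    · simpa only [hw] using hu _ _ (hv.comp hnk)
    · rw [hw' n hn]

variable {E : ∀ n, 𝓛 n → 𝓛 n → ℝ} {K : ℕ → ℝ} {E₀ : 𝓛₀ → 𝓛₀ → ℝ} {H₀ : Submodule ℝ 𝓛₀}
  {K₀ α₀ : ℝ} {G : ∀ n, ℝ → 𝓛 n →ₗ[ℝ] 𝓛 n} {G₀ : ℝ → 𝓛₀ →ₗ[ℝ] 𝓛₀}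

theorem CondF2.condF2' (hΦ : ∀ w : 𝓛₀, Tendsto (fun n => ‖Φ n w‖) atTop (𝓝 ‖w‖))
    (hH : ∀ n, Dense (H n : Set (𝓛 n))) (hcf₀ : IsClosedForm E₀ H₀ α₀ K₀)
    (hF2 : CondF2 (fun n => ⇑(Φ n)) E H E₀ H₀) :
    CondF2' (fun n => ⇑(Φ n)) E H E₀ H₀ α₀ := by
  intro nk hnk u u₀ huH hu₀ hu _
  obtain ⟨w, hw, hwH, hwW⟩ := exists_extension_wconv hΦ hH hnk huH hu
  refine ⟨H₀, subset_rfl, fun v hv ε hε => ⟨v, hv, ?_⟩, fun v₀ hv₀ => ?_⟩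
  · simpa [Hnorm, hcf₀.zero_left H₀.zero_mem] using hε
  · obtain ⟨v, hvH, hv, hlim⟩ := hF2 w u₀ hwH hu₀ hwW v₀ hv₀
    refine ⟨fun k => v (nk k), fun k => hvH _, hv.comp hnk, ?_⟩
    have h1 := hlim.comp hnk.tendsto_atTop
    simp only [Function.comp_def, hw] at h1
    exact ((continuous_coe_real_ereal.tendsto _).comp h1).liminf_eq.le

theorem condR_of_condF1_condF2' [CompleteSpace 𝓛₀] [TopologicalSpace.SeparableSpace 𝓛₀]
    (hΦ : ∀ w : 𝓛₀, Tendsto (fun n => ‖Φ n w‖) atTop (𝓝 ‖w‖))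
    (hcf : ∀ n, IsClosedForm (E n) (H n) α₀ (K n)) (hcf₀ : IsClosedForm E₀ H₀ α₀ K₀)
    (hG : ∀ n, IsResolventOf (E n) (H n) α₀ (G n)) (hG₀ : IsResolventOf E₀ H₀ α₀ G₀)
    (hF1 : CondF1 (fun n => ⇑(Φ n)) E H H₀ α₀)
    (hF2 : CondF2' (fun n => ⇑(Φ n)) E H E₀ H₀ α₀) :
    CondR (fun n => ⇑(Φ n)) G G₀ α₀ := by
  intro α hα f f₀ hf
  have key (u : ∀ n, 𝓛 n) (u₀ : 𝓛₀) (hu : WConv (fun n => ⇑(Φ n)) u u₀) :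
      Tendsto (fun n => ⟪u n, G n α (f n)⟫) atTop (𝓝 ⟪u₀, G₀ α f₀⟫) := by
    choose w hwH hw using fun n => (hcf n).exists_coresolvent hα (u n)
    have hwf (n : ℕ) (g : 𝓛 n) : ⟪u n, G n α g⟫ = ⟪w n, g⟫ := by
      rw [← hw n _ ((hG n).1 α hα g), (hG n).2.1 α hα g _ (hwH n), real_inner_comm]
    obtain ⟨C, hC⟩ := hu.exists_norm_le
    have hα' : 0 < α - α₀ := sub_pos.2 hα
    have hC0 : 0 ≤ C := (norm_nonneg _).trans (hC 0)
    have hwn (n : ℕ) : ‖w n‖ ≤ C / (α - α₀) := by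
      rw [le_div_iff₀ hα']
      have h1 := (hG n).2.2.2 α hα (w n)
      rw [norm_smul, Real.norm_of_nonneg hα'.le] at h1
      have h2 : ‖w n‖ * ‖w n‖ ≤ C * ‖G n α (w n)‖ := by
        rw [← real_inner_self_eq_norm_mul_norm, ← hwf]
        exact (real_inner_le_norm _ _).trans
          (mul_le_mul_of_nonneg_right (hC n) (norm_nonneg _))
      rcases (norm_nonneg (w n)).eq_or_lt with h0 | h0
      · rw [← h0, zero_mul]
        exact hC0
      · refine le_of_mul_le_mul_left ?_ h0
        nlinarith [mul_le_mul_of_nonneg_left h1 hC0]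
    let M := C + |α₀ + 1 - α| * (C / (α - α₀))
    have hTheta (n : ℕ) : Theta (E n) (H n) α₀ (w n) ≤ M := by
      refine (hcf n).Theta_le (by positivity) fun v hv => ?_
      have h1 : ⟪u n, v⟫ ≤ C * ‖v‖ := (real_inner_le_norm _ _).trans
        (mul_le_mul_of_nonneg_right (hC n) (norm_nonneg _))
      have h2 : (α₀ + 1 - α) * ⟪v, w n⟫ ≤ |α₀ + 1 - α| * (C / (α - α₀) * ‖v‖) := by
        refine (le_abs_self _).trans ?_
        rw [abs_mul, mul_comm (C / _)]
        exact mul_le_mul_of_nonneg_left ((abs_real_inner_le_norm _ _).trans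
          (mul_le_mul_of_nonneg_left (hwn n) (norm_nonneg _))) (abs_nonneg _)
      have h3 := hw n v hv
      simp only [M]
      linarith
    refine tendsto_of_subseq_tendsto fun ns hns => ?_
    obtain ⟨φ, hφ, hnsφ⟩ := strictMono_subseq_of_tendsto_atTop hns
    obtain ⟨ψ, w₀, hψ, hww⟩ := exists_subseq_wconv (𝓛 := fun k => 𝓛 ((ns ∘ φ) k))
      (Φ := fun k => Φ ((ns ∘ φ) k)) (u := fun k => w ((ns ∘ φ) k))
      (fun x => (hΦ x).comp hnsφ.tendsto_atTop) fun k => hwn _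
    have hnk : StrictMono fun k => ns (φ (ψ k)) := hnsφ.comp hψ
    have hw₀ : w₀ ∈ H₀ := by
      obtain ⟨z, hz, hzH, hzW⟩ := exists_extension_wconv hΦ (fun n => (hcf n).dense_dom) hnk
        (fun k => hwH _) hww
      refine hF1 z w₀ hzH hzW (lt_of_le_of_lt (liminf_le_of_frequently_le' (x := (M : EReal)) ?_)
        (EReal.coe_lt_top M))
      refine hnk.tendsto_atTop.frequently (Frequently.of_forall fun k => ?_)
      rw [hz]
      exact EReal.coe_le_coe_iff.2 (hTheta _)
    obtain ⟨D, hDH, hD, hDv⟩ := hF2 _ hnk _ w₀ (fun k => hwH _) hw₀ hww ⟨M, fun k => hTheta _⟩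
    have hle_dense (v : 𝓛₀) (hv : v ∈ D) : ⟪u₀, v⟫ ≤ E₀ v w₀ + α * ⟪v, w₀⟫ := by
      obtain ⟨x, hxH, hx, hliminf⟩ := hDv v hv
      have h1 := (hu.comp hnk _ _ hx).sub ((hww _ _ hx).const_mul α)
      have h2 (k : ℕ) : E _ (x k) (w (ns (φ (ψ k))))
          = ⟪u (ns (φ (ψ k))), x k⟫ - α * ⟪w (ns (φ (ψ k))), x k⟫ := by
        rw [real_inner_comm (x k) (w _)]
        linarith [hw _ _ (hxH k)]
      have h3 := ((continuous_coe_real_ereal.tendsto _).comp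
        (h1.congr fun k => (h2 k).symm)).liminf_eq
      have h4 := EReal.coe_le_coe_iff.1 (h3.symm.trans_le hliminf)
      rw [real_inner_comm v w₀] at h4
      linarith
    have hle (v : 𝓛₀) (hv : v ∈ H₀) : ⟪u₀, v⟫ ≤ E₀ v w₀ + α * ⟪v, w₀⟫ := by
      obtain ⟨N, hN0, hN⟩ := hcf₀.exists_abs_le_mul_Hnorm hw₀
      refine le_of_forall_pos_le_add fun ε hε => ?_
      let N' := N + |α| * ‖w₀‖ + ‖u₀‖ + 1
      have hN' : 0 < N' := by positivity
      obtain ⟨x, hxD, hx⟩ := hD v hv (ε / N') (by positivity)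
      have hxH : x ∈ H₀ := hDH hxD
      have hd := H₀.sub_mem hv hxH
      rw [lt_div_iff₀ hN'] at hx
      have hnorm := hcf₀.norm_le_Hnorm hd
      have h1 := (abs_le.1 (hN _ hd)).1
      rw [hcf₀.sub_left hv hxH hw₀] at h1
      have h2 : |α * ⟪v - x, w₀⟫| ≤ |α| * ‖w₀‖ * Hnorm E₀ α₀ (v - x) := by
        rw [abs_mul, mul_assoc, mul_comm ‖w₀‖]
        gcongr
        exact (abs_real_inner_le_norm _ _).trans (by gcongr)
      have h3 : ⟪u₀, v - x⟫ ≤ ‖u₀‖ * Hnorm E₀ α₀ (v - x) :=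
        (real_inner_le_norm _ _).trans (by gcongr)
      have h4 := (abs_le.1 h2).1
      rw [inner_sub_left, mul_sub] at h4
      rw [inner_sub_right] at h3
      have h5 := hle_dense x hxD
      have h6 : 0 ≤ Hnorm E₀ α₀ (v - x) := Real.sqrt_nonneg _
      simp only [N', mul_add] at hx
      linarith
    have heq : ⟪u₀, G₀ α f₀⟫ = ⟪w₀, f₀⟫ := by
      have hv := hG₀.1 α hα f₀
      rw [real_inner_comm f₀ w₀, ← hG₀.2.1 α hα f₀ w₀ hw₀]
      refine le_antisymm (hle _ hv) ?_
      have h1 := hle _ (H₀.neg_mem hv)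
      have h2 := hcf₀.smul_left (-1) _ _ hv hw₀
      rw [neg_one_smul] at h2
      rw [h2, inner_neg_right, inner_neg_left] at h1
      linarith
    refine ⟨fun k => φ (ψ k), ?_⟩
    simp only [hwf]
    rw [heq]
    exact hww _ _ (hf.comp hnk)
  have hweak : WConv (fun n => ⇑(Φ n)) (fun n => G n α (f n)) (G₀ α f₀) := by
    intro v v₀ hv
    simpa only [real_inner_comm] using key v v₀ (hv.wconv hΦ)
  exact hweak.sconv hΦ (key _ _ hweak)

theorem CondR.condF1 (hΦ : ∀ w : 𝓛₀, Tendsto (fun n => ‖Φ n w‖) atTop (𝓝 ‖w‖))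
    (hcf : ∀ n, IsClosedForm (E n) (H n) α₀ (K n)) (hcf₀ : IsClosedForm E₀ H₀ α₀ K₀)
    (hG : ∀ n, IsResolventOf (E n) (H n) α₀ (G n)) (hG₀ : IsResolventOf E₀ H₀ α₀ G₀)
    (hR : CondR (fun n => ⇑(Φ n)) G G₀ α₀) : CondF1 (fun n => ⇑(Φ n)) E H H₀ α₀ := by
  intro u u₀ huH hu hliminf
  have hα : α₀ < α₀ + 1 := by linarith
  obtain ⟨C, hC, -⟩ := EReal.lt_iff_exists_real_btwn.1 hliminf
  have hfreq := frequently_lt_of_liminf_lt (by isBoundedDefault) hC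
  refine hcf₀.mem_of_forall_inner_le hG₀ (C := C) fun f => ?_
  have hf := sconv_apply Φ f
  have hGf := hR _ hα _ _ hf
  have h1 : Tendsto (fun n => ⟪Φ n f, u n⟫) atTop (𝓝 ⟪f, u₀⟫) := by
    simpa only [real_inner_comm] using hu _ _ hf
  have h2 : Tendsto (fun n => Hnorm (E n) α₀ (G n (α₀ + 1) (Φ n f))) atTop
      (𝓝 (Hnorm E₀ α₀ (G₀ (α₀ + 1) f))) := by
    simp only [Hnorm, hG₀.2.1 _ hα f _ (hG₀.1 _ hα f),
      (hG _).2.1 _ hα _ _ ((hG _).1 _ hα _)]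
    exact (hf.wconv hΦ _ _ hGf).sqrt
  refine le_of_tendsto_of_tendsto_of_frequently h1 (h2.const_mul C) (hfreq.mono fun n hn => ?_)
  have hn' := EReal.coe_lt_coe_iff.1 hn
  have hmem := (hG n).1 _ hα (Φ n f)
  rw [← (hG n).2.1 _ hα (Φ n f) _ (huH n)]
  exact ((hcf n).le_Theta_mul (huH n) hmem).trans
    (mul_le_mul_of_nonneg_right hn'.le (Real.sqrt_nonneg _))

theorem CondR.condF2 (hΦ : ∀ w : 𝓛₀, Tendsto (fun n => ‖Φ n w‖) atTop (𝓝 ‖w‖))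
    (hcf₀ : IsClosedForm E₀ H₀ α₀ K₀)
    (hG : ∀ n, IsResolventOf (E n) (H n) α₀ (G n)) (hG₀ : IsResolventOf E₀ H₀ α₀ G₀)
    (hR : CondR (fun n => ⇑(Φ n)) G G₀ α₀) : CondF2 (fun n => ⇑(Φ n)) E H E₀ H₀ := by
  intro u u₀ huH hu₀ hu v₀ hv₀
  have hα : α₀ < α₀ + 1 := by linarith
  obtain ⟨M, hM0, hM⟩ := hcf₀.exists_abs_le_mul_Hnorm hu₀
  obtain ⟨v, hvH, hv⟩ := exists_seq_tendsto_zero (P := fun n x => x ∈ H n)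
    (err := fun n x => ‖Φ n v₀ - x‖ + |E n x (u n) - E₀ v₀ u₀|)
    (fun n => ⟨0, (H n).zero_mem⟩) (fun n x => by positivity) fun ε hε => by
      obtain ⟨f, hf⟩ := hcf₀.exists_resolvent_Hnorm_sub_lt hG₀ hv₀
        (show 0 < ε / (1 + M) by positivity)
      have hgH := hG₀.1 _ hα f
      have hd := H₀.sub_mem hv₀ hgH
      have hGf := hR _ hα _ _ (sconv_apply Φ f)
      have hE : Tendsto (fun n => E n (G n (α₀ + 1) (Φ n f)) (u n)) atTop
          (𝓝 (E₀ (G₀ (α₀ + 1) f) u₀)) := by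
        have h1 := (hu _ _ (sconv_apply Φ f)).sub ((hu _ _ hGf).const_mul (α₀ + 1))
        rw [real_inner_comm, real_inner_comm (G₀ (α₀ + 1) f),
          ← hG₀.2.1 _ hα f _ hu₀, add_sub_cancel_right] at h1
        refine h1.congr fun n => ?_
        rw [real_inner_comm, real_inner_comm (G n _ _), ← (hG n).2.1 _ hα (Φ n f) _ (huH n),
          add_sub_cancel_right]
      have hnorm := ((hΦ (v₀ - G₀ (α₀ + 1) f)).add hGf).add
        (hE.sub_const (E₀ v₀ u₀)).abs
      refine (hnorm.eventually_lt_const (u := ε) ?_).mono fun n hn =>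
        ⟨_, (hG n).1 _ hα (Φ n f), lt_of_le_of_lt ?_ hn⟩
      · have h1 := hM _ hd
        rw [hcf₀.sub_left hv₀ hgH hu₀, abs_sub_comm] at h1
        have h2 := hcf₀.norm_le_Hnorm hd
        rw [lt_div_iff₀ (by positivity)] at hf
        linarith
      · gcongr
        rw [map_sub]
        exact norm_sub_le_norm_sub_add_norm_sub _ _ _
  refine ⟨v, hvH, squeeze_zero (fun _ => norm_nonneg _)
    (fun n => le_add_of_nonneg_right (abs_nonneg _)) hv, ?_⟩
  exact tendsto_iff_dist_tendsto_zero.2 (squeeze_zero (fun _ => dist_nonneg)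
    (fun n => le_add_of_nonneg_left (norm_nonneg _)) hv)

end Linear

/-- Let `(ℰⁿ, 𝓗_n)` and `(ℰ, 𝓗)` be closed bilinear forms (with a common
`α₀`) on the converging family of separable Hilbert spaces `𝓛_n → 𝓛`, with associated
resolvents `(Gⁿ_α)` and `(G_α)`.  Then
(i) `(F1) ∧ (F2)` (Mosco convergence of `ℰⁿ` to `ℰ`) is equivalent to `(F1) ∧ (F2')`; and
(ii) `(F1) ∧ (F2)` is equivalent to `(R)`. -/
theorem mosco_convergence_characterization
    [∀ n, CompleteSpace (𝓛 n)] [∀ n, TopologicalSpace.SeparableSpace (𝓛 n)]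
    [CompleteSpace 𝓛₀] [TopologicalSpace.SeparableSpace 𝓛₀]
    (Φ : ∀ n, 𝓛₀ →ₗ[ℝ] 𝓛 n)
    (hΦ : ∀ w : 𝓛₀, Tendsto (fun n => ‖Φ n w‖) atTop (𝓝 ‖w‖))
    (E : ∀ n, 𝓛 n → 𝓛 n → ℝ) (H : ∀ n, Submodule ℝ (𝓛 n)) (K : ℕ → ℝ)
    (E₀ : 𝓛₀ → 𝓛₀ → ℝ) (H₀ : Submodule ℝ 𝓛₀) (K₀ α₀ : ℝ)
    (hcf : ∀ n, IsClosedForm (E n) (H n) α₀ (K n))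
    (hcf₀ : IsClosedForm E₀ H₀ α₀ K₀)
    (G : ∀ n, ℝ → 𝓛 n →ₗ[ℝ] 𝓛 n) (G₀ : ℝ → 𝓛₀ →ₗ[ℝ] 𝓛₀)
    (hG : ∀ n, IsResolventOf (E n) (H n) α₀ (G n))
    (hG₀ : IsResolventOf E₀ H₀ α₀ G₀) :
    ((CondF1 (fun n => ⇑(Φ n)) E H H₀ α₀ ∧ CondF2 (fun n => ⇑(Φ n)) E H E₀ H₀) ↔
      (CondF1 (fun n => ⇑(Φ n)) E H H₀ α₀ ∧ CondF2' (fun n => ⇑(Φ n)) E H E₀ H₀ α₀)) ∧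
    ((CondF1 (fun n => ⇑(Φ n)) E H H₀ α₀ ∧ CondF2 (fun n => ⇑(Φ n)) E H E₀ H₀) ↔
      CondR (fun n => ⇑(Φ n)) G G₀ α₀) := by
  have h12 : CondF2 (fun n => ⇑(Φ n)) E H E₀ H₀ → CondF2' (fun n => ⇑(Φ n)) E H E₀ H₀ α₀ :=
    CondF2.condF2' hΦ (fun n => (hcf n).dense_dom) hcf₀
  have hR := condR_of_condF1_condF2' hΦ hcf hcf₀ hG hG₀
  have h1 : CondR (fun n => ⇑(Φ n)) G G₀ α₀ → CondF1 (fun n => ⇑(Φ n)) E H H₀ α₀ :=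
    CondR.condF1 hΦ hcf hcf₀ hG hG₀
  have h2 : CondR (fun n => ⇑(Φ n)) G G₀ α₀ → CondF2 (fun n => ⇑(Φ n)) E H E₀ H₀ :=
    CondR.condF2 hΦ hcf₀ hG hG₀
  exact ⟨⟨fun h => ⟨h.1, h12 h.2⟩, fun h => ⟨h.1, h2 (hR h.1 h.2)⟩⟩,
    ⟨fun h => hR h.1 (h12 h.2), fun h => ⟨h1 h, h2 h⟩⟩⟩

end MoscoSetting

end
end

section
/- In the Hilbert-convergence setting, assume each Φ_n is bounded and sup_n ‖Φ_n‖_op < ∞. For each n let (Tⁿ_t)_{t≥0} be a strongly continuous semigroup on 𝓛_n with ‖e^{−α₀ t}Tⁿ_t‖_op ≤ 1 and let Gⁿ_α f := ∫₀^∞ e^{−αt}Tⁿ_t f dt for α > α₀; similarly let (T_t) be a strongly continuous semigroup on 𝓛 with ‖e^{−α₀ t}T_t‖_op ≤ 1 and G_α its Laplace-transform resolvent. Then the following are equivalent: (1) for some α > α₀, Gⁿ_α converges strongly to G_α; (2) for every t ≥ 0, Tⁿ_t converges strongly to T_t; (3) for every T > 0 and every sequence (f_n), f_n ∈ 𝓛_n,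 converging strongly to f ∈ 𝓛, lim_{n→∞} sup_{t∈[0,T]} ‖Tⁿ_t f_n − Φ_n T_t f‖_{𝓛_n} = 0. -/
open Filter Topology MeasureTheory

noncomputable section

/-- `(T_t)_{t≥0}` is a strongly continuous semigroup with `‖e^{−α₀ t} T_t‖ ≤ 1` for `t > 0`. -/
def IsSCSemigroup {E : Type*} [NormedAddCommGroup E] [NormedSpace ℝ E]
    (α₀ : ℝ) (T : ℝ → E →L[ℝ] E) : Prop :=
  T 0 = ContinuousLinearMap.id ℝ E ∧
  (∀ s ≥ (0:ℝ), ∀ t ≥ (0:ℝ), T (s + t) = (T s).comp (T t)) ∧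
  (∀ f : E, Tendsto (fun t : ℝ => T t f) (𝓝[>] (0:ℝ)) (𝓝 f)) ∧
  (∀ t > (0:ℝ), ‖T t‖ ≤ Real.exp (α₀ * t))

/-- The Laplace-transform resolvent `G_α f = ∫₀^∞ e^{−α t} T_t f dt`. -/
def laplaceG {E : Type*} [NormedAddCommGroup E] [NormedSpace ℝ E] [CompleteSpace E]
    (T : ℝ → E →L[ℝ] E) (α : ℝ) (f : E) : E :=
  ∫ t in Set.Ioi (0:ℝ), Real.exp (-α * t) • T t f

variable {𝓛 : ℕ → Type*} [∀ n, NormedAddCommGroup (𝓛 n)] [∀ n, InnerProductSpace ℝ (𝓛 n)]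
  [∀ n, CompleteSpace (𝓛 n)] [∀ n, TopologicalSpace.SeparableSpace (𝓛 n)]
  {𝓛₀ : Type*} [NormedAddCommGroup 𝓛₀] [InnerProductSpace ℝ 𝓛₀] [CompleteSpace 𝓛₀]
  [TopologicalSpace.SeparableSpace 𝓛₀]

namespace IsSCSemigroup

variable {E : Type*} [NormedAddCommGroup E] [NormedSpace ℝ E] {β : ℝ} {S : ℝ → E →L[ℝ] E}

lemma apply_zero (h : IsSCSemigroup β S) (f : E) : S 0 f = f := by
  rw [h.1, ContinuousLinearMap.id_apply]

lemma apply_add (h : IsSCSemigroup β S) {s t : ℝ} (hs : 0 ≤ s) (ht : 0 ≤ t) (f : E) :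
    S (s + t) f = S s (S t f) := by
  rw [h.2.1 s hs t ht, ContinuousLinearMap.comp_apply]

lemma apply_comm (h : IsSCSemigroup β S) {s t : ℝ} (hs : 0 ≤ s) (ht : 0 ≤ t) (f : E) :
    S s (S t f) = S t (S s f) := by
  rw [← h.apply_add hs ht, add_comm, h.apply_add ht hs]

lemma norm_le (h : IsSCSemigroup β S) {t : ℝ} (ht : 0 ≤ t) : ‖S t‖ ≤ Real.exp (β * t) := by
  rcases ht.eq_or_lt with rfl | ht
  · rw [h.1, mul_zero, Real.exp_zero]
    exact ContinuousLinearMap.norm_id_le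
  · exact h.2.2.2 t ht

lemma norm_apply_le (h : IsSCSemigroup β S) {t : ℝ} (ht : 0 ≤ t) (f : E) :
    ‖S t f‖ ≤ Real.exp (β * t) * ‖f‖ :=
  (S t).le_of_opNorm_le (h.norm_le ht) f

lemma norm_apply_le_self (h : IsSCSemigroup β S) (hβ : β < 0) {t : ℝ} (ht : 0 ≤ t) (f : E) :
    ‖S t f‖ ≤ ‖f‖ := by
  refine (h.norm_apply_le ht f).trans (mul_le_of_le_one_left (norm_nonneg f) ?_)
  exact Real.exp_le_one_iff.2 (mul_nonpos_of_nonpos_of_nonneg hβ.le ht)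

lemma rescale (h : IsSCSemigroup β S) (α : ℝ) :
    IsSCSemigroup (β - α) (fun t => Real.exp (-α * t) • S t) := by
  refine ⟨by simp [h.1], fun s hs t ht => ?_, fun f => ?_, fun t ht => ?_⟩
  · ext f
    simp [h.apply_add hs ht, mul_add, Real.exp_add, smul_smul, mul_comm]
  · have h1 : Tendsto (fun t : ℝ => Real.exp (-α * t)) (𝓝[>] 0) (𝓝 1) := by
      have : ContinuousAt (fun t : ℝ => Real.exp (-α * t)) 0 := by fun_prop
      simpa using this.tendsto.mono_left nhdsWithin_le_nhds
    simpa using h1.smul (h.2.2.1 f)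
  · rw [norm_smul, Real.norm_of_nonneg (Real.exp_pos _).le, sub_mul, sub_eq_neg_add, Real.exp_add,
      neg_mul]
    exact mul_le_mul_of_nonneg_left (h.2.2.2 t ht) (Real.exp_pos _).le

lemma norm_apply_sub_apply_le (h : IsSCSemigroup β S) (hβ : β < 0) {s t : ℝ} (hs : 0 ≤ s)
    (ht : 0 ≤ t) (f : E) : ‖S s f - S t f‖ ≤ ‖S |s - t| f - f‖ := by
  wlog hst : s ≤ t generalizing s t
  · rw [norm_sub_rev, abs_sub_comm]
    exact this ht hs (le_of_not_ge hst)
  have hd : 0 ≤ t - s := sub_nonneg.2 hst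
  have : S t f = S s (S (t - s) f) := by rw [← h.apply_add hs hd]; simp
  rw [abs_sub_comm, abs_of_nonneg hd, this, ← map_sub, norm_sub_rev (S (t - s) f)]
  exact h.norm_apply_le_self hβ hs _

lemma continuousOn (h : IsSCSemigroup β S) (hβ : β < 0) (f : E) :
    ContinuousOn (fun t => S t f) (Set.Ici 0) := by
  intro t ht
  have h0 : ContinuousWithinAt (fun t => S t f) (Set.Ici 0) 0 := by
    rw [← continuousWithinAt_Ioi_iff_Ici, ContinuousWithinAt, h.apply_zero]
    exact h.2.2.1 f
  have h1 : Tendsto (fun s : ℝ => |s - t|) (𝓝[Set.Ici 0] t) (𝓝[Set.Ici 0] 0) := by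
    refine tendsto_nhdsWithin_iff.2 ⟨?_, Eventually.of_forall fun s => Set.mem_Ici.2 (abs_nonneg _)⟩
    have : ContinuousAt (fun s : ℝ => |s - t|) t := by fun_prop
    simpa using this.tendsto.mono_left nhdsWithin_le_nhds
  have h2 : Tendsto (fun s : ℝ => ‖S |s - t| f - f‖) (𝓝[Set.Ici 0] t) (𝓝 0) := by
    have := ((h0.tendsto.comp h1).sub_const f).norm
    simpa [h.apply_zero] using this
  refine tendsto_iff_norm_sub_tendsto_zero.2 (squeeze_zero' ?_ ?_ h2)
  · exact Eventually.of_forall fun s => norm_nonneg _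
  · filter_upwards [self_mem_nhdsWithin] with s hs
    exact h.norm_apply_sub_apply_le hβ hs ht f

lemma continuousOn_apply (h : IsSCSemigroup β S) (hβ : β < 0) {K : Set ℝ} {r : ℝ → ℝ} {x : ℝ → E}
    (hr : ContinuousOn r K) (hx : ContinuousOn x K) (hrK : Set.MapsTo r K (Set.Ici 0)) :
    ContinuousOn (fun s => S (r s) (x s)) K := by
  intro s hs
  have h1 : Tendsto (fun u => ‖x u - x s‖) (𝓝[K] s) (𝓝 0) :=
    tendsto_iff_norm_sub_tendsto_zero.1 (hx s hs)
  have h2 : Tendsto (fun u => ‖S (r u) (x s) - S (r s) (x s)‖) (𝓝[K] s) (𝓝 0) :=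
    tendsto_iff_norm_sub_tendsto_zero.1 (((h.continuousOn hβ (x s)).comp hr hrK) s hs)
  refine tendsto_iff_norm_sub_tendsto_zero.2 (squeeze_zero' ?_ ?_ (by simpa using h1.add h2))
  · exact Eventually.of_forall fun s => norm_nonneg _
  · filter_upwards [self_mem_nhdsWithin] with u hu
    have : S (r u) (x u) - S (r s) (x s) =
        S (r u) (x u - x s) + (S (r u) (x s) - S (r s) (x s)) := by rw [map_sub]; abel
    rw [this]
    exact (norm_add_le _ _).trans
      (add_le_add_left (h.norm_apply_le_self hβ (hrK hu) _) _)

lemma integrableOn (h : IsSCSemigroup β S) (hβ : β < 0) (f : E) :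
    IntegrableOn (fun t => S t f) (Set.Ioi 0) := by
  refine Integrable.mono' ((integrableOn_exp_mul_Ioi hβ 0).mul_const ‖f‖) ?_ ?_
  · exact ((h.continuousOn hβ f).mono Set.Ioi_subset_Ici_self).aestronglyMeasurable
      measurableSet_Ioi
  · filter_upwards [ae_restrict_mem measurableSet_Ioi] with t ht
    exact h.norm_apply_le (le_of_lt ht) f

/-- The resolvent at `0` of a strongly continuous semigroup of negative growth rate. -/
def resolventZero (h : IsSCSemigroup β S) (hβ : β < 0) : E →L[ℝ] E :=
  LinearMap.mkContinuous
    { toFun := fun f => ∫ t in Set.Ioi (0 : ℝ), S t f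
      map_add' := fun f g => by
        simp only [map_add]
        exact integral_add (h.integrableOn hβ f) (h.integrableOn hβ g)
      map_smul' := fun c f => by
        simp only [map_smul, RingHom.id_apply]
        exact integral_smul c _ }
    (-β)⁻¹ fun f => by
      have h1 : ∫ t in Set.Ioi (0 : ℝ), Real.exp (β * t) * ‖f‖ = (-β)⁻¹ * ‖f‖ := by
        rw [integral_mul_const, integral_exp_mul_Ioi hβ 0]
        rw [mul_zero, Real.exp_zero, inv_neg, neg_div, one_div]
      rw [← h1]
      refine norm_integral_le_of_norm_le ((integrableOn_exp_mul_Ioi hβ 0).mul_const ‖f‖) ?_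
      filter_upwards [ae_restrict_mem measurableSet_Ioi] with t ht
      exact h.norm_apply_le (le_of_lt ht) f

lemma resolventZero_apply (h : IsSCSemigroup β S) (hβ : β < 0) (f : E) :
    h.resolventZero hβ f = ∫ t in Set.Ioi (0 : ℝ), S t f := rfl

lemma norm_resolventZero_le (h : IsSCSemigroup β S) (hβ : β < 0) :
    ‖h.resolventZero hβ‖ ≤ (-β)⁻¹ :=
  LinearMap.mkContinuous_norm_le _ (inv_nonneg.2 (neg_nonneg.2 hβ.le)) _

variable [CompleteSpace E]

lemma apply_resolventZero (h : IsSCSemigroup β S) (hβ : β < 0) {t : ℝ} (ht : 0 ≤ t) (f : E) :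
    S t (h.resolventZero hβ f) = h.resolventZero hβ (S t f) := by
  rw [resolventZero_apply, resolventZero_apply,
    ← ContinuousLinearMap.integral_comp_comm _ (h.integrableOn hβ f)]
  exact setIntegral_congr_fun measurableSet_Ioi fun s hs => h.apply_comm ht (le_of_lt hs) f

lemma apply_resolventZero_eq_sub (h : IsSCSemigroup β S) (hβ : β < 0) {t : ℝ} (ht : 0 ≤ t)
    (f : E) : S t (h.resolventZero hβ f) = h.resolventZero hβ f - ∫ s in (0 : ℝ)..t, S s f := by
  have h1 : ∫ s in Set.Ioi t, S s f = ∫ s in Set.Ioi (0 : ℝ), S (s + t) f := by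
    have := (measurePreserving_add_right (volume : Measure ℝ) t).setIntegral_preimage_emb
      (measurableEmbedding_addRight t) (fun s => S s f) (Set.Ioi t)
    rw [← this]
    simp
  have h2 : ∫ s in Set.Ioi (0 : ℝ), S (s + t) f = S t (h.resolventZero hβ f) := by
    rw [h.apply_resolventZero hβ ht, resolventZero_apply]
    exact setIntegral_congr_fun measurableSet_Ioi fun s hs => h.apply_add (le_of_lt hs) ht f
  rw [← h2, ← h1, resolventZero_apply,
    ← intervalIntegral.integral_Ioi_sub_Ioi (h.integrableOn hβ f) ht, sub_sub_cancel]

lemma hasDerivWithinAt_apply_resolventZero (h : IsSCSemigroup β S) (hβ : β < 0) (f : E) :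
    HasDerivWithinAt (fun t => S t (h.resolventZero hβ f)) (-f) (Set.Ici 0) 0 := by
  have hc := h.continuousOn hβ f
  have h1 : HasDerivWithinAt (fun t => ∫ s in (0 : ℝ)..t, S s f) (S 0 f) (Set.Ici 0) 0 := by
    refine intervalIntegral.integral_hasDerivWithinAt_right (t := Set.Ioi 0) (by simp) ?_
      ((hc 0 Set.self_mem_Ici).mono Set.Ioi_subset_Ici_self)
    exact (hc.mono Set.Ioi_subset_Ici_self).stronglyMeasurableAtFilter_nhdsWithin
      measurableSet_Ioi 0
  rw [h.apply_zero] at h1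
  exact (h1.const_sub (h.resolventZero hβ f)).congr
    (fun t ht => h.apply_resolventZero_eq_sub hβ ht f)
    (h.apply_resolventZero_eq_sub hβ le_rfl f)

lemma denseRange_resolventZero (h : IsSCSemigroup β S) (hβ : β < 0) :
    DenseRange (h.resolventZero hβ) := by
  intro f
  have h1 := (h.hasDerivWithinAt_apply_resolventZero hβ (-f)).Ioi_of_Ici
  rw [neg_neg, hasDerivWithinAt_iff_tendsto_slope' Set.self_notMem_Ioi] at h1
  refine mem_closure_of_tendsto h1 ?_
  filter_upwards [self_mem_nhdsWithin] with t ht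
  refine ⟨(t - 0)⁻¹ • (S t (-f) - S 0 (-f)), ?_⟩
  rw [slope_def_module, h.apply_resolventZero hβ (le_of_lt ht), h.apply_resolventZero hβ le_rfl,
    map_smul, map_sub]

lemma norm_resolventZero_commutator_le {F : Type*} [NormedAddCommGroup F] [NormedSpace ℝ F]
    [CompleteSpace F] {S' : ℝ → F →L[ℝ] F} (h : IsSCSemigroup β S) (h' : IsSCSemigroup β S')
    (hβ : β < 0) (Φ : E →L[ℝ] F) {t ε : ℝ} (ht : 0 ≤ t) (f : E)
    (hε : ∀ s ∈ Set.Icc 0 t,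
      ‖Φ (h.resolventZero hβ (S s f)) - h'.resolventZero hβ (Φ (S s f))‖ < ε) :
    ‖h'.resolventZero hβ (Φ (S t (h.resolventZero hβ f))) -
      S' t (h'.resolventZero hβ (Φ (h.resolventZero hβ f)))‖ ≤ ε * t := by
  set G := h.resolventZero hβ with hG
  set G' := h'.resolventZero hβ with hG'
  set w : ℝ → F := fun s => S' (t - s) (G' (Φ (S s (G f)))) - S' t (G' (Φ (G f))) with hw
  have hcont : ContinuousOn w (Set.Icc 0 t) := by
    refine ContinuousOn.sub (h'.continuousOn_apply hβ (by fun_prop) ?_ ?_) continuousOn_const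
    · exact G'.continuous.comp_continuousOn (Φ.continuous.comp_continuousOn
        ((h.continuousOn hβ (G f)).mono Set.Icc_subset_Ici_self))
    · intro s hs
      exact sub_nonneg.2 hs.2
  have hslope : ∀ x ∈ Set.Ico 0 t, ∀ r, ‖Φ (G (S x f)) - G' (Φ (S x f))‖ < r →
      ∃ᶠ z in 𝓝[>] x, slope (norm ∘ w) x z < r := by
    intro x hx r hr
    set v := S x f with hv
    have hd : HasDerivWithinAt (fun u => G' (Φ (S u (G v))) - S' u (G' (Φ (G v))))
        (Φ (G v) - G' (Φ v)) (Set.Ici 0) 0 := by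
      have h1 := (G'.comp Φ).hasFDerivAt.comp_hasDerivWithinAt 0
        (h.hasDerivWithinAt_apply_resolventZero hβ v)
      have h2 := h1.sub (h'.hasDerivWithinAt_apply_resolventZero hβ (Φ (G v)))
      refine h2.congr_deriv ?_
      simp only [ContinuousLinearMap.comp_apply, map_neg]
      abel
    have hd' := hd.Ioi_of_Ici.limsup_norm_slope_le hr
    have htend : Tendsto (fun z : ℝ => z - x) (𝓝[>] x) (𝓝[>] 0) := by
      refine tendsto_nhdsWithin_iff.2 ⟨?_, ?_⟩
      · have : ContinuousAt (fun z : ℝ => z - x) x := by fun_prop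
        simpa using this.tendsto.mono_left nhdsWithin_le_nhds
      · filter_upwards [self_mem_nhdsWithin] with z hz
        exact Set.mem_Ioi.2 (sub_pos.2 (Set.mem_Ioi.1 hz))
    refine Eventually.frequently ?_
    filter_upwards [htend.eventually hd', Ioo_mem_nhdsGT hx.2] with z hz hzt
    refine lt_of_le_of_lt ?_ hz
    have hzx : 0 < z - x := sub_pos.2 hzt.1
    rw [slope_def_field, div_eq_inv_mul, sub_zero, Real.norm_of_nonneg hzx.le]
    refine mul_le_mul_of_nonneg_left ((norm_sub_norm_le _ _).trans ?_) (inv_nonneg.2 hzx.le)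
    have e1 : S z (G f) = S (z - x) (G v) := by
      rw [hv, ← h.apply_resolventZero hβ hx.1, ← h.apply_add hzx.le hx.1, sub_add_cancel]
    have e2 : S x (G f) = G v := h.apply_resolventZero hβ hx.1 f
    have e3 : S' (t - x) (G' (Φ (G v))) = S' (t - z) (S' (z - x) (G' (Φ (G v)))) := by
      rw [← h'.apply_add (sub_nonneg.2 hzt.2.le) hzx.le, sub_add_sub_cancel]
    simp only [hw, e1, e2, e3, h.apply_zero, h'.apply_zero, sub_self,
      sub_zero]
    rw [sub_sub_sub_cancel_right, ← map_sub]
    exact h'.norm_apply_le_self hβ (sub_nonneg.2 hzt.2.le) _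
  have hmain := image_norm_le_of_liminf_right_slope_norm_lt_deriv_boundary hcont hslope
    (B := fun s => ε * s) (B' := fun _ => ε) (by simp [hw, h.apply_zero]) (by fun_prop)
    (fun x _ => by simpa using ((hasDerivAt_id x).const_mul ε).hasDerivWithinAt)
    (fun x hx _ => hε x ⟨hx.1, hx.2.le⟩) (Set.right_mem_Icc.2 ht)
  simpa [hw, h'.apply_zero] using hmain

end IsSCSemigroup

lemma eventually_forall_norm_lt_of_isCompact {E : Type*} [NormedAddCommGroup E] [NormedSpace ℝ E]
    {F : ℕ → Type*} [∀ n, NormedAddCommGroup (F n)] [∀ n, NormedSpace ℝ (F n)]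
    {R : ∀ n, E →L[ℝ] F n} {M : ℝ} (hM : ∀ n, ‖R n‖ ≤ M)
    (hR : ∀ x, Tendsto (fun n => ‖R n x‖) atTop (𝓝 0)) {K : Set E} (hK : IsCompact K)
    {ε : ℝ} (hε : 0 < ε) : ∀ᶠ n in atTop, ∀ x ∈ K, ‖R n x‖ < ε := by
  refine hK.induction_on (by simp) (fun s t hst ht => ?_) (fun s t hs ht => ?_) fun x _ => ?_
  · exact ht.mono fun n hn x hx => hn x (hst hx)
  · filter_upwards [hs, ht] with n h1 h2 x hx
    exact hx.elim (h1 x) (h2 x)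
  · have hM0 : 0 ≤ M := (norm_nonneg _).trans (hM 0)
    refine ⟨Metric.ball x (ε / (2 * (M + 1))),
      mem_nhdsWithin_of_mem_nhds (Metric.ball_mem_nhds x (by positivity)), ?_⟩
    filter_upwards [(hR x).eventually_lt_const (half_pos hε)] with n hn y hy
    have h1 : ‖R n (y - x)‖ ≤ ε / 2 := by
      rw [mem_ball_iff_norm] at hy
      calc ‖R n (y - x)‖ ≤ M * ‖y - x‖ := (R n).le_of_opNorm_le (hM n) _
        _ ≤ (M + 1) * (ε / (2 * (M + 1))) := by gcongr; linarith
        _ = ε / 2 := by field_simp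
    calc ‖R n y‖ = ‖R n (y - x) + R n x‖ := by rw [← map_add, sub_add_cancel]
      _ ≤ ‖R n (y - x)‖ + ‖R n x‖ := norm_add_le _ _
      _ < ε := by linarith

section Convergence

variable {E : Type*} [NormedAddCommGroup E] [NormedSpace ℝ E] [CompleteSpace E]
  {F : ℕ → Type*} [∀ n, NormedAddCommGroup (F n)] [∀ n, NormedSpace ℝ (F n)]
  [∀ n, CompleteSpace (F n)] {Φ : ∀ n, E →L[ℝ] F n} {C β : ℝ}
  {S : ∀ n, ℝ → F n →L[ℝ] F n} {S₀ : ℝ → E →L[ℝ] E}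

lemma eventually_forall_norm_semigroup_sub_lt (hC : ∀ n, ‖Φ n‖ ≤ C)
    (hS : ∀ n, IsSCSemigroup β (S n)) (hS₀ : IsSCSemigroup β S₀) (hβ : β < 0)
    (hG : ∀ x, Tendsto (fun n => ‖Φ n (hS₀.resolventZero hβ x) -
      (hS n).resolventZero hβ (Φ n x)‖) atTop (𝓝 0))
    {τ : ℝ} (hτ : 0 ≤ τ) (f : E) {ε : ℝ} (hε : 0 < ε) :
    ∀ᶠ n in atTop, ∀ t ∈ Set.Icc 0 τ, ‖S n t (Φ n f) - Φ n (S₀ t f)‖ < ε := by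
  set G₀ := hS₀.resolventZero hβ with hG₀
  set G := fun n => (hS n).resolventZero hβ with hGn
  have hC0 : 0 ≤ C := (norm_nonneg _).trans (hC 0)
  have hK0 : 0 ≤ (-β)⁻¹ := inv_nonneg.2 (neg_nonneg.2 hβ.le)
  obtain ⟨g, hg⟩ : ∃ g, ‖f - G₀ (G₀ g)‖ < ε / (4 * (C + 1)) := by
    have hd : DenseRange (G₀ ∘ G₀) :=
      (hS₀.denseRange_resolventZero hβ).comp (hS₀.denseRange_resolventZero hβ) G₀.continuous
    obtain ⟨g, hg⟩ := hd.exists_dist_lt f (ε := ε / (4 * (C + 1))) (by positivity)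
    exact ⟨g, by rwa [dist_eq_norm] at hg⟩
  set δ := ε / (2 * (τ + 2)) with hδ
  have hδ0 : 0 < δ := by positivity
  have hcomm : ∀ v : E, ∀ᶠ n in atTop, ∀ x ∈ (fun s => S₀ s v) '' Set.Icc 0 τ,
      ‖((Φ n).comp G₀ - (G n).comp (Φ n)) x‖ < δ := by
    intro v
    refine eventually_forall_norm_lt_of_isCompact (M := C * (-β)⁻¹ + (-β)⁻¹ * C) (fun n => ?_)
      hG ?_ hδ0
    · refine (norm_sub_le _ _).trans (add_le_add ?_ ?_)
      · exact (ContinuousLinearMap.opNorm_comp_le _ _).trans (mul_le_mul (hC n)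
          (hS₀.norm_resolventZero_le hβ) (norm_nonneg _) hC0)
      · exact (ContinuousLinearMap.opNorm_comp_le _ _).trans (mul_le_mul
          ((hS n).norm_resolventZero_le hβ) (hC n) (norm_nonneg _) hK0)
    · exact isCompact_Icc.image_of_continuousOn
        ((hS₀.continuousOn hβ v).mono Set.Icc_subset_Ici_self)
  filter_upwards [hcomm g, hcomm (G₀ g)] with n hn1 hn2 t ht
  have hR1 : ∀ s ∈ Set.Icc 0 τ, ‖Φ n (G₀ (S₀ s g)) - G n (Φ n (S₀ s g))‖ < δ :=
    fun s hs => hn1 _ ⟨s, hs, rfl⟩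
  have hR2 : ∀ s ∈ Set.Icc 0 τ, ‖Φ n (G₀ (S₀ s (G₀ g))) - G n (Φ n (S₀ s (G₀ g)))‖ < δ :=
    fun s hs => hn2 _ ⟨s, hs, rfl⟩
  set u := G₀ (G₀ g) with hu
  have hA : ‖G n (Φ n (S₀ t (G₀ g))) - S n t (G n (Φ n (G₀ g)))‖ ≤ δ * τ :=
    (hS₀.norm_resolventZero_commutator_le (hS n) hβ (Φ n) ht.1 g
      fun s hs => hR1 s ⟨hs.1, hs.2.trans ht.2⟩).trans
      (mul_le_mul_of_nonneg_left ht.2 hδ0.le)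
  have hB : ‖Φ n (S₀ t u) - G n (Φ n (S₀ t (G₀ g)))‖ < δ := by
    rw [hu, hS₀.apply_resolventZero hβ ht.1]
    exact hR2 t ht
  have hD : ‖S n t (Φ n u - G n (Φ n (G₀ g)))‖ < δ := by
    refine ((hS n).norm_apply_le_self hβ ht.1 _).trans_lt ?_
    simpa [hS₀.apply_zero] using hR2 0 ⟨le_rfl, hτ⟩
  have hfu : ‖Φ n (f - u)‖ ≤ ε / 4 := by
    calc ‖Φ n (f - u)‖ ≤ C * ‖f - u‖ := (Φ n).le_of_opNorm_le (hC n) _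
      _ ≤ (C + 1) * (ε / (4 * (C + 1))) := by gcongr; linarith
      _ = ε / 4 := by field_simp
  have hfu' : ‖Φ n (S₀ t (f - u))‖ ≤ ε / 4 := by
    calc ‖Φ n (S₀ t (f - u))‖ ≤ C * ‖S₀ t (f - u)‖ := (Φ n).le_of_opNorm_le (hC n) _
      _ ≤ C * ‖f - u‖ := by gcongr; exact hS₀.norm_apply_le_self hβ ht.1 _
      _ ≤ (C + 1) * (ε / (4 * (C + 1))) := by gcongr; linarith
      _ = ε / 4 := by field_simp
  have hfu'' := ((hS n).norm_apply_le_self hβ ht.1 (Φ n (f - u))).trans hfu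
  have hsum : S n t (Φ n f) - Φ n (S₀ t f) =
      S n t (Φ n (f - u)) - Φ n (S₀ t (f - u)) + (S n t (Φ n u - G n (Φ n (G₀ g))) -
        (Φ n (S₀ t u) - G n (Φ n (S₀ t (G₀ g)))) -
        (G n (Φ n (S₀ t (G₀ g))) - S n t (G n (Φ n (G₀ g))))) := by
    simp only [map_sub]
    abel
  have hδτ : δ * τ + 2 * δ = ε / 2 := by
    rw [hδ]
    field_simp
  rw [hsum]
  have n1 := norm_add_le (S n t (Φ n (f - u)) - Φ n (S₀ t (f - u)))
    (S n t (Φ n u - G n (Φ n (G₀ g))) - (Φ n (S₀ t u) - G n (Φ n (S₀ t (G₀ g)))) -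
      (G n (Φ n (S₀ t (G₀ g))) - S n t (G n (Φ n (G₀ g)))))
  have n2 := norm_sub_le (S n t (Φ n (f - u))) (Φ n (S₀ t (f - u)))
  have n3 := norm_sub_le
    (S n t (Φ n u - G n (Φ n (G₀ g))) - (Φ n (S₀ t u) - G n (Φ n (S₀ t (G₀ g)))))
    (G n (Φ n (S₀ t (G₀ g))) - S n t (G n (Φ n (G₀ g))))
  have n4 := norm_sub_le (S n t (Φ n u - G n (Φ n (G₀ g))))
    (Φ n (S₀ t u) - G n (Φ n (S₀ t (G₀ g))))
  linarith

lemma tendsto_norm_resolventZero_sub (hC : ∀ n, ‖Φ n‖ ≤ C)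
    (hS : ∀ n, IsSCSemigroup β (S n)) (hS₀ : IsSCSemigroup β S₀) (hβ : β < 0)
    {u : ∀ n, F n} {u₀ : E} {M : ℝ} (hM : ∀ n, ‖u n‖ ≤ M)
    (hu : ∀ t > 0, Tendsto (fun n => ‖Φ n (S₀ t u₀) - S n t (u n)‖) atTop (𝓝 0)) :
    Tendsto (fun n => ‖Φ n (hS₀.resolventZero hβ u₀) - (hS n).resolventZero hβ (u n)‖)
      atTop (𝓝 0) := by
  have hC0 : 0 ≤ C := (norm_nonneg _).trans (hC 0)
  have hint : ∀ n, IntegrableOn (fun t => Φ n (S₀ t u₀) - S n t (u n)) (Set.Ioi 0) := fun n =>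
    ((Φ n).integrable_comp (hS₀.integrableOn hβ u₀)).sub ((hS n).integrableOn hβ (u n))
  have hlim : Tendsto (fun n => ∫ t in Set.Ioi (0 : ℝ), ‖Φ n (S₀ t u₀) - S n t (u n)‖) atTop
      (𝓝 (∫ _ in Set.Ioi (0 : ℝ), (0 : ℝ))) := by
    refine tendsto_integral_of_dominated_convergence
      (fun t => Real.exp (β * t) * (C * ‖u₀‖ + M)) (fun n => (hint n).norm.aestronglyMeasurable)
      ((integrableOn_exp_mul_Ioi hβ 0).mul_const _) (fun n => ?_) ?_
    · filter_upwards [ae_restrict_mem measurableSet_Ioi] with t ht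
      have ht0 : 0 ≤ t := le_of_lt ht
      rw [norm_norm]
      calc ‖Φ n (S₀ t u₀) - S n t (u n)‖ ≤ ‖Φ n (S₀ t u₀)‖ + ‖S n t (u n)‖ := norm_sub_le _ _
        _ ≤ C * (Real.exp (β * t) * ‖u₀‖) + Real.exp (β * t) * M := by
          refine add_le_add (((Φ n).le_of_opNorm_le (hC n) _).trans ?_)
            (((hS n).norm_apply_le ht0 _).trans ?_)
          · exact mul_le_mul_of_nonneg_left (hS₀.norm_apply_le ht0 _) hC0
          · exact mul_le_mul_of_nonneg_left (hM n) (Real.exp_pos _).le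
        _ = Real.exp (β * t) * (C * ‖u₀‖ + M) := by ring
    · filter_upwards [ae_restrict_mem measurableSet_Ioi] with t ht
      exact hu t ht
  rw [integral_zero] at hlim
  refine squeeze_zero (fun n => norm_nonneg _) (fun n => ?_) hlim
  rw [IsSCSemigroup.resolventZero_apply, IsSCSemigroup.resolventZero_apply,
    ← ContinuousLinearMap.integral_comp_comm _ (hS₀.integrableOn hβ u₀),
    ← integral_sub ((Φ n).integrable_comp (hS₀.integrableOn hβ u₀))
      ((hS n).integrableOn hβ (u n))]
  exact norm_integral_le_integral_norm _

end Convergence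

/-- With identification maps `Φ_n : 𝓛 → 𝓛_n` such that `‖Φ_n u‖ → ‖u‖`
and `sup_n ‖Φ_n‖ < ∞`, and strongly continuous semigroups `(Tⁿ_t)` on `𝓛_n`, `(T_t)` on `𝓛`
with `‖e^{−α₀ t}·‖ ≤ 1` and Laplace-transform resolvents `Gⁿ_α`, `G_α`, the following are
equivalent: (1) `Gⁿ_α → G_α` strongly for some `α > α₀`; (2) `Tⁿ_t → T_t` strongly for all
`t ≥ 0`; (3) `Tⁿ_t → T_t` strongly, uniformly on bounded time intervals. -/
theorem semigroup_resolvent_convergence_correspondence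
    (Φ : ∀ n, 𝓛₀ →L[ℝ] 𝓛 n)
    (hΦ : ∀ w : 𝓛₀, Tendsto (fun n => ‖Φ n w‖) atTop (𝓝 ‖w‖))
    (hΦbdd : ∃ C : ℝ, ∀ n, ‖Φ n‖ ≤ C)
    (α₀ : ℝ) (T : ∀ n, ℝ → 𝓛 n →L[ℝ] 𝓛 n) (T₀ : ℝ → 𝓛₀ →L[ℝ] 𝓛₀)
    (hT : ∀ n, IsSCSemigroup α₀ (T n)) (hT₀ : IsSCSemigroup α₀ T₀) :
    -- (1) ↔ (2)
    ((∃ α > α₀, ∀ (u : ∀ n, 𝓛 n) (u₀ : 𝓛₀), SConv (fun n => ⇑(Φ n)) u u₀ →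
        SConv (fun n => ⇑(Φ n)) (fun n => laplaceG (T n) α (u n)) (laplaceG T₀ α u₀)) ↔
      (∀ t ≥ (0:ℝ), ∀ (u : ∀ n, 𝓛 n) (u₀ : 𝓛₀), SConv (fun n => ⇑(Φ n)) u u₀ →
        SConv (fun n => ⇑(Φ n)) (fun n => T n t (u n)) (T₀ t u₀))) ∧
    -- (2) ↔ (3)
    ((∀ t ≥ (0:ℝ), ∀ (u : ∀ n, 𝓛 n) (u₀ : 𝓛₀), SConv (fun n => ⇑(Φ n)) u u₀ →
        SConv (fun n => ⇑(Φ n)) (fun n => T n t (u n)) (T₀ t u₀)) ↔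
      (∀ Tmax > (0:ℝ), ∀ (f : ∀ n, 𝓛 n) (f₀ : 𝓛₀), SConv (fun n => ⇑(Φ n)) f f₀ →
        ∀ ε > (0:ℝ), ∀ᶠ n in atTop, ∀ t ∈ Set.Icc (0:ℝ) Tmax,
          ‖T n t (f n) - Φ n (T₀ t f₀)‖ < ε)) := by
  obtain ⟨C, hC⟩ := hΦbdd
  have h12 : (∃ α > α₀, ∀ (u : ∀ n, 𝓛 n) (u₀ : 𝓛₀), SConv (fun n => ⇑(Φ n)) u u₀ →
        SConv (fun n => ⇑(Φ n)) (fun n => laplaceG (T n) α (u n)) (laplaceG T₀ α u₀)) →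
      (∀ Tmax > (0:ℝ), ∀ (f : ∀ n, 𝓛 n) (f₀ : 𝓛₀), SConv (fun n => ⇑(Φ n)) f f₀ →
        ∀ ε > (0:ℝ), ∀ᶠ n in atTop, ∀ t ∈ Set.Icc (0:ℝ) Tmax,
          ‖T n t (f n) - Φ n (T₀ t f₀)‖ < ε) := by
    rintro ⟨α, hα, hconv⟩ τ hτ f f₀ hf ε hε
    have hβ : α₀ - α < 0 := sub_neg.2 hα
    have hG : ∀ x, Tendsto (fun n => ‖Φ n ((hT₀.rescale α).resolventZero hβ x) -
        ((hT n).rescale α).resolventZero hβ (Φ n x)‖) atTop (𝓝 0) := fun x =>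
      hconv (fun n => Φ n x) x (by simp [SConv])
    set M := Real.exp (|α| * τ) with hM
    have hM0 : 0 < M := Real.exp_pos _
    have hε' : 0 < ε / (2 * M) := by positivity
    filter_upwards [eventually_forall_norm_semigroup_sub_lt hC (fun n => (hT n).rescale α)
      (hT₀.rescale α) hβ hG hτ.le f₀ hε', hf.eventually_lt_const hε'] with n h1 h2 t ht
    have hexp : Real.exp (α * t) ≤ M := by
      refine Real.exp_le_exp.2 ?_
      calc α * t ≤ |α| * t := mul_le_mul_of_nonneg_right (le_abs_self α) ht.1
        _ ≤ |α| * τ := mul_le_mul_of_nonneg_left ht.2 (abs_nonneg α)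
    have h3 := ((hT n).rescale α).norm_apply_le_self hβ ht.1 (f n - Φ n f₀)
    rw [norm_sub_rev (f n)] at h3
    have h4 : T n t (f n) - Φ n (T₀ t f₀) = Real.exp (α * t) •
        ((Real.exp (-α * t) • T n t) (f n - Φ n f₀) +
          ((Real.exp (-α * t) • T n t) (Φ n f₀) - Φ n ((Real.exp (-α * t) • T₀ t) f₀))) := by
      have h5 : Real.exp (α * t) * Real.exp (-α * t) = 1 := by
        rw [← Real.exp_add]; simp
      simp only [smul_apply, map_sub, map_smul, ← smul_sub, ← smul_add,
        smul_smul, h5, one_smul]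
      abel
    rw [h4, norm_smul, Real.norm_of_nonneg (Real.exp_pos _).le]
    calc _ ≤ M * _ := mul_le_mul_of_nonneg_right hexp (norm_nonneg _)
      _ < M * (ε / (2 * M) + ε / (2 * M)) := mul_lt_mul_of_pos_left
          ((norm_add_le _ _).trans_lt (add_lt_add (h3.trans_lt h2) (h1 t ht))) hM0
      _ = ε := by field_simp; ring
  have h32 : (∀ Tmax > (0:ℝ), ∀ (f : ∀ n, 𝓛 n) (f₀ : 𝓛₀), SConv (fun n => ⇑(Φ n)) f f₀ →
        ∀ ε > (0:ℝ), ∀ᶠ n in atTop, ∀ t ∈ Set.Icc (0:ℝ) Tmax,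
          ‖T n t (f n) - Φ n (T₀ t f₀)‖ < ε) →
      (∀ t ≥ (0:ℝ), ∀ (u : ∀ n, 𝓛 n) (u₀ : 𝓛₀), SConv (fun n => ⇑(Φ n)) u u₀ →
        SConv (fun n => ⇑(Φ n)) (fun n => T n t (u n)) (T₀ t u₀)) := by
    intro h t ht u u₀ hu
    refine Metric.tendsto_nhds.2 fun ε hε => ?_
    filter_upwards [h (t + 1) (by positivity) u u₀ hu ε hε] with n hn
    simpa [norm_sub_rev] using hn t ⟨ht, by linarith⟩
  have h21 : (∀ t ≥ (0:ℝ), ∀ (u : ∀ n, 𝓛 n) (u₀ : 𝓛₀), SConv (fun n => ⇑(Φ n)) u u₀ →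
        SConv (fun n => ⇑(Φ n)) (fun n => T n t (u n)) (T₀ t u₀)) →
      ∃ α > α₀, ∀ (u : ∀ n, 𝓛 n) (u₀ : 𝓛₀), SConv (fun n => ⇑(Φ n)) u u₀ →
        SConv (fun n => ⇑(Φ n)) (fun n => laplaceG (T n) α (u n)) (laplaceG T₀ α u₀) := by
    intro h
    refine ⟨α₀ + 1, lt_add_one α₀, fun u u₀ hu => ?_⟩
    have hβ : α₀ - (α₀ + 1) < 0 := by linarith
    obtain ⟨B, hB⟩ := Tendsto.bddAbove_range hu
    have hM : ∀ n, ‖u n‖ ≤ C * ‖u₀‖ + B := fun n => by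
      have h1 := norm_le_norm_add_norm_sub (Φ n u₀) (u n)
      have h2 := (Φ n).le_of_opNorm_le (hC n) u₀
      have h3 : ‖Φ n u₀ - u n‖ ≤ B := hB ⟨n, rfl⟩
      linarith
    refine tendsto_norm_resolventZero_sub hC (fun n => (hT n).rescale (α₀ + 1))
      (hT₀.rescale (α₀ + 1)) hβ hM fun t ht => ?_
    have h1 : Tendsto (fun n => ‖Φ n (T₀ t u₀) - T n t (u n)‖) atTop (𝓝 0) := h t ht.le u u₀ hu
    have h2 := h1.const_mul (Real.exp (-(α₀ + 1) * t))
    rw [mul_zero] at h2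
    refine h2.congr fun n => ?_
    rw [smul_apply, smul_apply, map_smul, ← smul_sub,
      norm_smul, Real.norm_of_nonneg (Real.exp_pos _).le]
  exact ⟨⟨fun h => h32 (h12 h), h21⟩, ⟨fun h => h12 (h21 h), h32⟩⟩

end
end
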